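/- arXiv:2110.04785 — 12 statements merged into one kernel-verified Lean document; each statement's English description precedes it below -/
import Mathlib

section
/- Let F be a field of characteristic 2, p an odd prime, τ ≥ 1, and let g ∈ F[x] divide 1 + x^τ + ⋯ + x^{(p−1)τ} with g coprime to 1 + x^τ; let h ∈ F[x] be defined by g·h = 1 + x^τ + ⋯ + x^{(p−1)τ}. Assume g and h are coprime and 1 + x^τ and h are coprime in F[x]. Let k ≥ 1 and r ≥ 2 be integers with k + r ≤ pτ. Then the code GEBR(p, τ, k, r, g) is MDS (i.e., for every subset T ⊆ {0, …, k+r−1} with |T| = k, the only codeword (s_0, …, s_{k+r−1}) with s_j = 0 for all j ∈ T is the zero codeword) if and only if 1 + x^i and h are coprime in F[x] for every i = 1, 2, …, k+r−1. -/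
open Polynomial

/-- A Lagrange interpolation form of the invertibility of a Vandermonde system: if `a` divides the
first `#J` power sums `∑ j ∈ J, v j ^ ℓ * s j`, then it divides `s i * ∏ j ∈ J \ {i}, (v i - v j)`
for every `i ∈ J`. -/
theorem dvd_mul_prod_sub_of_dvd_sum_pow_mul {R ι : Type*} [CommRing R] [DecidableEq ι] {a : R}
    {J : Finset ι} {v s : ι → R} (H : ∀ ℓ < J.card, a ∣ ∑ j ∈ J, v j ^ ℓ * s j) {i : ι}
    (hi : i ∈ J) : a ∣ s i * ∏ j ∈ J.erase i, (v i - v j) := by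
  nontriviality R
  set P : R[X] := ∏ j ∈ J.erase i, (X - C (v j)) with hP
  have hdeg : P.natDegree < J.card := by
    rw [hP, natDegree_finsetProd_X_sub_C_eq_card, Finset.card_erase_of_mem hi]
    exact Nat.sub_lt (Finset.card_pos.mpr ⟨i, hi⟩) one_pos
  have heval : ∀ y, P.eval y = ∏ j ∈ J.erase i, (y - v j) := fun y => by
    simp [hP, eval_prod]
  have hsum : ∑ ℓ ∈ Finset.range J.card, P.coeff ℓ * ∑ j ∈ J, v j ^ ℓ * s j =
      s i * ∏ j ∈ J.erase i, (v i - v j) := by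
    simp_rw [Finset.mul_sum]
    rw [Finset.sum_comm, Finset.sum_eq_single i]
    · rw [← heval, eval_eq_sum_range' hdeg, Finset.mul_sum]
      exact Finset.sum_congr rfl fun _ _ => by ring
    · intro b hb hbi
      have h0 : P.eval (v b) = 0 := by
        rw [heval]
        exact Finset.prod_eq_zero (Finset.mem_erase.mpr ⟨hbi, hb⟩) (sub_self _)
      rw [eval_eq_sum_range' hdeg] at h0
      calc _ = (∑ ℓ ∈ Finset.range J.card, P.coeff ℓ * v b ^ ℓ) * s b := by
            rw [Finset.sum_mul]
            exact Finset.sum_congr rfl fun _ _ => by ring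
        _ = 0 := by rw [h0, zero_mul]
    · exact fun h => absurd hi h
  rw [← hsum]
  exact Finset.dvd_sum fun ℓ hℓ => (H ℓ (Finset.mem_range.mp hℓ)).mul_left _

/-- In characteristic two, `X ^ i - X ^ j` is coprime to `h` as soon as `X` and `1 + X ^ |i - j|`
are. -/
theorem isCoprime_X_pow_sub_X_pow {R : Type*} [CommRing R] [CharP R 2] {h : R[X]}
    (hX : IsCoprime X h) {n : ℕ}
    (H : ∀ i, 1 ≤ i → i ≤ n - 1 → IsCoprime (1 + X ^ i : R[X]) h) {i j : ℕ} (hi : i < n)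
    (hj : j < n) (hij : i ≠ j) : IsCoprime (X ^ i - X ^ j : R[X]) h := by
  wlog hlt : j < i generalizing i j
  · have := this hj hi hij.symm (by omega)
    rwa [← neg_sub, IsCoprime.neg_left_iff]
  obtain ⟨m, rfl⟩ := Nat.exists_eq_add_of_lt hlt
  have : (X ^ (j + m + 1) - X ^ j : R[X]) = X ^ j * (1 + X ^ (m + 1)) := by
    rw [CharTwo.sub_eq_add]; ring
  rw [this]
  exact hX.pow_left.mul_left (H _ (by omega) (by omega))

theorem one_add_X_pow_mul_sum {R : Type*} [CommRing R] [CharP R 2] (p τ : ℕ) :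
    (1 + X ^ τ : R[X]) * ∑ i ∈ Finset.range p, X ^ (i * τ) = 1 + X ^ (p * τ) := by
  have := mul_neg_geom_sum (X ^ τ : R[X]) p
  simpa only [CharTwo.sub_eq_add, ← pow_mul, mul_comm τ] using this

theorem one_add_X_pow_dvd_one_add_X_pow_mul {R : Type*} [CommRing R] [CharP R 2] (i ℓ : ℕ) :
    (1 + X ^ i : R[X]) ∣ 1 + X ^ (ℓ * i) :=
  ⟨_, (one_add_X_pow_mul_sum ℓ i).symm⟩

theorem stmt_3 (F : Type*) [Field F] [CharP F 2]
    (p τ k r : ℕ) (hp : p.Prime) (hodd : p ≠ 2) (hτ : 1 ≤ τ)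
    (g h : F[X]) (hgdvd : g ∣ ∑ i ∈ Finset.range p, (X : F[X]) ^ (i * τ))
    (hgcop : IsCoprime g (1 + X ^ τ))
    (hgh : g * h = ∑ i ∈ Finset.range p, (X : F[X]) ^ (i * τ))
    (hcop1 : IsCoprime g h) (hcop2 : IsCoprime (1 + X ^ τ : F[X]) h)
    (hk : 1 ≤ k) (hr : 2 ≤ r) (hkr : k + r ≤ p * τ) :
    ((∀ T : Finset ℕ, T ⊆ Finset.range (k + r) → T.card = k →
        ∀ s : ℕ → F[X],
          (∀ j < k + r, (s j).degree < (p * τ : ℕ) ∧ (1 + X ^ τ) * g ∣ s j) →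
          (∀ ℓ < r, (1 + X ^ (p * τ) : F[X]) ∣
              ∑ j ∈ Finset.range (k + r), X ^ (ℓ * j) * s j) →
          (∀ j ∈ T, s j = 0) → ∀ j < k + r, s j = 0) ↔
      (∀ i, 1 ≤ i → i ≤ k + r - 1 → IsCoprime (1 + X ^ i : F[X]) h)) := by
  have hM : (1 + X ^ τ) * g * h = (1 + X ^ (p * τ) : F[X]) := by
    rw [mul_assoc, hgh, one_add_X_pow_mul_sum]
  have hpos : 0 < p * τ := by omega
  have hMdeg : (1 + X ^ (p * τ) : F[X]).degree = (p * τ : ℕ) := by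
    rw [add_comm, ← C_1, degree_X_pow_add_C hpos]
  have hM0 : (1 + X ^ (p * τ) : F[X]) ≠ 0 := by
    rw [← degree_ne_bot, hMdeg]
    exact WithBot.natCast_ne_bot _
  have hG0 : (1 + X ^ τ) * g ≠ 0 := left_ne_zero_of_mul (hM ▸ hM0)
  have hh0 : h ≠ 0 := right_ne_zero_of_mul (hM ▸ hM0)
  constructor
  · intro hMDS i hi hik
    by_contra hcop
    obtain ⟨d, hd, ⟨hdi, e, rfl⟩⟩ : ∃ d : F[X], ¬ IsUnit d ∧ d ∣ 1 + X ^ i ∧ d ∣ h := by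
      by_contra! hno
      exact hcop (IsRelPrime.isCoprime fun d h1 h2 => by_contra fun hd => hno d hd h1 h2)
    have he0 : e ≠ 0 := right_ne_zero_of_mul hh0
    have hd0 : d ≠ 0 := left_ne_zero_of_mul hh0
    have hs0 : (1 + X ^ τ) * g * e ≠ 0 := mul_ne_zero hG0 he0
    obtain ⟨T, hT, hTk⟩ : ∃ T ⊆ Finset.range (k + r) \ {0, i}, T.card = k := by
      apply Finset.exists_subset_card_eq
      have := Finset.le_card_sdiff {0, i} (Finset.range (k + r))
      have h2 : ({0, i} : Finset ℕ).card ≤ 2 := Finset.card_le_two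
      rw [Finset.card_range] at this
      omega
    set s : ℕ → F[X] := fun j => if j ∈ ({0, i} : Finset ℕ) then (1 + X ^ τ) * g * e else 0
      with hs
    have hs00 : s 0 = (1 + X ^ τ) * g * e := by simp [hs]
    refine hs0 (hs00 ▸ hMDS T (hT.trans Finset.sdiff_subset) hTk s ?_ ?_ ?_ 0 (by omega))
    · intro j _
      by_cases hj : j ∈ ({0, i} : Finset ℕ)
      · simp only [hs, if_pos hj]
        refine ⟨?_, dvd_mul_right _ _⟩
        rw [← hMdeg, ← hM, show (1 + X ^ τ) * g * (d * e) = (1 + X ^ τ) * g * e * d by ring]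
        have hdpos := natDegree_pos_iff_degree_pos.mpr (degree_pos_of_ne_zero_of_nonunit hd0 hd)
        refine degree_lt_degree ?_
        rw [natDegree_mul hs0 hd0]
        exact Nat.lt_add_of_pos_right hdpos
      · simp only [hs, if_neg hj]
        exact ⟨degree_zero (R := F) ▸ WithBot.bot_lt_coe (p * τ), dvd_zero _⟩
    · intro ℓ _
      have hsub : ({0, i} : Finset ℕ) ⊆ Finset.range (k + r) := by
        intro j hj
        simp only [Finset.mem_insert, Finset.mem_singleton] at hj
        rw [Finset.mem_range]; omega
      have hsum : ∑ j ∈ Finset.range (k + r), X ^ (ℓ * j) * s j =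
          (1 + X ^ τ) * g * e * (1 + X ^ (ℓ * i)) := by
        rw [← Finset.sum_subset hsub fun j _ hj => by simp only [hs, if_neg hj, mul_zero],
          Finset.sum_pair (by omega)]
        simp [hs]
        ring
      rw [hsum, ← hM, show (1 + X ^ τ) * g * (d * e) = (1 + X ^ τ) * g * e * d by ring]
      exact mul_dvd_mul_left _ (hdi.trans (one_add_X_pow_dvd_one_add_X_pow_mul i ℓ))
    · intro j hj
      simp only [hs, if_neg (Finset.mem_sdiff.mp (hT hj)).2]
  · intro H T hT hTk s hs hcheck hsT j hj
    by_cases hjT : j ∈ T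
    · exact hsT j hjT
    have hXh : IsCoprime X h := by
      have hXM : IsCoprime (X : F[X]) (1 + X ^ (p * τ)) := by
        refine ⟨-X ^ (p * τ - 1), 1, ?_⟩
        rw [neg_mul, pow_sub_one_mul hpos.ne']
        ring
      exact hXM.of_isCoprime_of_dvd_right (hM ▸ dvd_mul_left _ _)
    have hcard : (Finset.range (k + r) \ T).card = r := by
      rw [Finset.card_sdiff_of_subset hT, Finset.card_range, hTk, Nat.add_sub_cancel_left]
    have hdvd : h ∣ s j * ∏ i ∈ (Finset.range (k + r) \ T).erase j, (X ^ j - X ^ i) := by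
      refine dvd_mul_prod_sub_of_dvd_sum_pow_mul (v := fun j => X ^ j) (fun ℓ hℓ => ?_)
        (Finset.mem_sdiff.mpr ⟨Finset.mem_range.mpr hj, hjT⟩)
      rw [hcard] at hℓ
      have hsum : ∑ j ∈ Finset.range (k + r) \ T, (X ^ j) ^ ℓ * s j =
          ∑ j ∈ Finset.range (k + r), X ^ (ℓ * j) * s j := by
        simp_rw [← pow_mul, mul_comm ℓ]
        refine Finset.sum_subset Finset.sdiff_subset fun i hi hiT => ?_
        rw [hsT i (by simpa [Finset.mem_range.mp hi] using hiT), mul_zero]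
      rw [hsum]
      exact (hM ▸ dvd_mul_left _ _ : h ∣ 1 + X ^ (p * τ)).trans (hcheck ℓ hℓ)
    have hprod : IsCoprime h (∏ i ∈ (Finset.range (k + r) \ T).erase j, (X ^ j - X ^ i)) := by
      refine IsCoprime.prod_right fun i hi => IsCoprime.symm ?_
      obtain ⟨hij, hi⟩ := Finset.mem_erase.mp hi
      exact isCoprime_X_pow_sub_X_pow hXh H hj
        (Finset.mem_range.mp (Finset.mem_sdiff.mp hi).1) hij.symm
    refine eq_zero_of_dvd_of_degree_lt (p := 1 + X ^ (p * τ)) ?_ (hMdeg ▸ (hs j hj).1)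
    rw [← hM]
    exact (hcop2.mul_left hcop1).mul_dvd (hs j hj).2 (hprod.dvd_of_dvd_mul_right hdvd)
end

section
/- Let F be a field of characteristic 2, p an odd prime, τ ≥ 1, and let g ∈ F[x] divide 1 + x^τ + ⋯ + x^{(p−1)τ} with g coprime to 1 + x^τ; let h be defined by g·h = 1 + x^τ + ⋯ + x^{(p−1)τ}, and assume g and h are coprime and 1 + x^τ and h are coprime in F[x]. Let k ≥ 1 and r ≥ 2 with k + r ≤ pτ. Then GEBR(p, τ, k, r, g) is MDS if and only if for every i ∈ {1, …, k+r−1} and every c ∈ C_{pτ}(g) there exists exactly one s ∈ C_{pτ}(g) such that (1 + x^{pτ}) divides (1 + x^i)·s − c. -/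
open Polynomial

theorem one_add_pow_mul_geom_sum {R : Type*} [CommRing R] [CharP R 2] (x : R) (τ p : ℕ) :
    (1 + x ^ τ) * ∑ i ∈ Finset.range p, x ^ (i * τ) = 1 + x ^ (p * τ) := by
  have h := mul_geom_sum (x ^ τ) p
  simp only [← pow_mul, CharTwo.sub_eq_add, mul_comm τ] at h
  rw [add_comm 1, h, add_comm]

theorem one_add_dvd_one_add_pow_mul {R : Type*} [CommRing R] [CharP R 2] (x : R) (i ℓ : ℕ) :
    1 + x ^ i ∣ 1 + x ^ (ℓ * i) :=
  ⟨_, (one_add_pow_mul_geom_sum x i ℓ).symm⟩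

theorem degree_one_add_X_pow {F : Type*} [Field F] {n : ℕ} (hn : 0 < n) :
    (1 + X ^ n : F[X]).degree = n := by
  rw [add_comm, ← C_1, degree_X_pow_add_C hn]

theorem isCoprime_X_pow_of_dvd_one_add_X_pow {F : Type*} [Field F] {h : F[X]} {n : ℕ}
    (hn : 0 < n) (hdvd : h ∣ 1 + X ^ n) (m : ℕ) : IsCoprime (X ^ m) h := by
  refine IsCoprime.pow_left (IsCoprime.of_isCoprime_of_dvd_right ?_ hdvd)
  refine ⟨-X ^ (n - 1), 1, ?_⟩
  rw [neg_mul, ← pow_succ, Nat.sub_add_cancel hn]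
  ring

theorem eq_zero_of_degree_lt_of_dvd {F : Type*} [Field F] {A h s : F[X]} {n : ℕ} (hn : 0 < n)
    (hAh : A * h = 1 + X ^ n) (hcop : IsCoprime A h) (hs : s.degree < n)
    (hA : A ∣ s) (hh : h ∣ s) : s = 0 := by
  refine eq_zero_of_dvd_of_degree_lt (hcop.mul_dvd hA hh) ?_
  rwa [hAh, degree_one_add_X_pow hn]

theorem exists_degree_lt_dvd_dvd_sub {F : Type*} [Field F] {A h : F[X]} {n : ℕ} (hn : 0 < n)
    (hAh : A * h = 1 + X ^ n) (hcop : IsCoprime A h) (t : F[X]) :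
    ∃ s : F[X], (s.degree < n ∧ A ∣ s) ∧ h ∣ s - t := by
  obtain ⟨a, b, hab⟩ := hcop
  have hdeg := degree_one_add_X_pow (F := F) hn
  have hne : (1 + X ^ n : F[X]) ≠ 0 := by
    intro h0
    simp [h0] at hdeg
  have hmod := EuclideanDomain.div_add_mod (t * (a * A)) (1 + X ^ n)
  refine ⟨t * (a * A) % (1 + X ^ n), ⟨?_, ?_⟩, ?_⟩
  · rw [← hdeg]
    exact degree_mod_lt _ hne
  · rw [← eq_sub_iff_add_eq'] at hmod
    rw [hmod, ← hAh]
    exact dvd_sub ⟨t * a, by ring⟩ ⟨h * (t * (a * A) / (A * h)), by ring⟩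
  · rw [← eq_sub_iff_add_eq'] at hmod
    rw [hmod, ← hAh]
    refine ⟨-(t * b) - A * (t * (a * A) / (A * h)), ?_⟩
    linear_combination t * hab

theorem dvd_sum_eval_mul_of_dvd_sum_pow_mul {R ι : Type*} [CommRing R] {h : R} {r : ℕ}
    (J : Finset ι) (x s : ι → R)
    (hs : ∀ ℓ < r, h ∣ ∑ j ∈ J, x j ^ ℓ * s j) {f : R[X]} (hf : f.natDegree < r) :
    h ∣ ∑ j ∈ J, f.eval (x j) * s j := by
  have hsum : ∑ j ∈ J, f.eval (x j) * s j =
      ∑ ℓ ∈ Finset.range r, f.coeff ℓ * ∑ j ∈ J, x j ^ ℓ * s j := by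
    simp_rw [eval_eq_sum_range' hf, Finset.sum_mul, Finset.mul_sum, mul_assoc]
    exact Finset.sum_comm
  rw [hsum]
  exact Finset.dvd_sum fun ℓ hℓ => (hs ℓ (Finset.mem_range.1 hℓ)).mul_left _

theorem dvd_of_dvd_sum_pow_mul_of_isCoprime_sub {R ι : Type*} [CommRing R] {h : R}
    (J : Finset ι) (x s : ι → R)
    (hcop : ∀ i ∈ J, ∀ j ∈ J, i ≠ j → IsCoprime (x i - x j) h)
    (hs : ∀ ℓ < J.card, h ∣ ∑ j ∈ J, x j ^ ℓ * s j) {i : ι} (hi : i ∈ J) : h ∣ s i := by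
  classical
  nontriviality R
  have hdeg : (∏ j ∈ J.erase i, (X - C (x j))).natDegree < J.card := by
    rw [natDegree_finsetProd_X_sub_C_eq_card]
    exact Finset.card_erase_lt_of_mem hi
  have hdvd := dvd_sum_eval_mul_of_dvd_sum_pow_mul J x s hs hdeg
  rw [Finset.sum_eq_single_of_mem i hi] at hdvd
  · refine IsCoprime.dvd_of_dvd_mul_left (IsCoprime.symm ?_) hdvd
    rw [eval_prod]
    refine IsCoprime.prod_left fun j hj => ?_
    simpa using hcop i hi j (Finset.mem_of_mem_erase hj) (Finset.ne_of_mem_erase hj).symm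
  · intro j hj hji
    rw [eval_prod, Finset.prod_eq_zero (Finset.mem_erase.2 ⟨hji, hj⟩) (by simp), zero_mul]

theorem isCoprime_X_pow_sub_X_pow_s4 {F : Type*} [Field F] [CharP F 2] {h : F[X]} {N : ℕ}
    (hX : ∀ m, IsCoprime (X ^ m : F[X]) h)
    (hcop : ∀ i, 1 ≤ i → i ≤ N - 1 → IsCoprime (1 + X ^ i) h) {a b : ℕ}
    (ha : a < N) (hb : b < N) (hab : a ≠ b) : IsCoprime (X ^ a - X ^ b : F[X]) h := by
  wlog hlt : a < b generalizing a b
  · rw [← neg_sub, IsCoprime.neg_left_iff]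
    exact this hb ha hab.symm (by omega)
  have hfac : (X ^ a - X ^ b : F[X]) = X ^ a * (1 + X ^ (b - a)) := by
    rw [CharTwo.sub_eq_add, mul_add, ← pow_add, Nat.add_sub_cancel' hlt.le, mul_one]
  rw [hfac]
  exact (hX a).mul_left (hcop _ (by omega) (by omega))

theorem isCoprime_of_forall_eq_zero {F : Type*} [Field F] {A h q : F[X]} {n : ℕ} (hn : 0 < n)
    (hAh : A * h = 1 + X ^ n) (hcop : IsCoprime A h)
    (hinj : ∀ s : F[X], s.degree < n → A ∣ s → h ∣ q * s → s = 0) : IsCoprime q h := by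
  classical
  have hne : h ≠ 0 := by
    rintro rfl
    have hdeg := degree_one_add_X_pow (F := F) hn
    simp [← hAh] at hdeg
  obtain ⟨e, he⟩ := EuclideanDomain.gcd_dvd_right q h
  obtain ⟨s, ⟨hsdeg, hsA⟩, hse⟩ := exists_degree_lt_dvd_dvd_sub hn hAh hcop e
  have hqe : h ∣ q * e := by
    conv_lhs => rw [he]
    exact mul_dvd_mul_right (EuclideanDomain.gcd_dvd_left q h) e
  have hqs : h ∣ q * s := by
    have := (hse.mul_left q).add hqe
    rwa [mul_sub, sub_add_cancel] at this
  rw [hinj s hsdeg hsA hqs, zero_sub, dvd_neg] at hse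
  rw [← EuclideanDomain.gcd_isUnit_iff]
  have he0 : e ≠ 0 := by
    rintro rfl
    exact hne (by rw [he, mul_zero])
  rw [he] at hse
  obtain ⟨u, hu⟩ := hse
  refine .of_mul_eq_one u (mul_left_cancel₀ he0 ?_)
  linear_combination -hu

theorem stmt_4 (F : Type*) [Field F] [CharP F 2]
    (p τ k r : ℕ) (hp : p.Prime) (hodd : p ≠ 2) (hτ : 1 ≤ τ)
    (g h : F[X]) (hgdvd : g ∣ ∑ i ∈ Finset.range p, (X : F[X]) ^ (i * τ))
    (hgcop : IsCoprime g (1 + X ^ τ))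
    (hgh : g * h = ∑ i ∈ Finset.range p, (X : F[X]) ^ (i * τ))
    (hcop1 : IsCoprime g h) (hcop2 : IsCoprime (1 + X ^ τ : F[X]) h)
    (hk : 1 ≤ k) (hr : 2 ≤ r) (hkr : k + r ≤ p * τ) :
    ((∀ T : Finset ℕ, T ⊆ Finset.range (k + r) → T.card = k →
        ∀ s : ℕ → F[X],
          (∀ j < k + r, (s j).degree < (p * τ : ℕ) ∧ (1 + X ^ τ) * g ∣ s j) →
          (∀ ℓ < r, (1 + X ^ (p * τ) : F[X]) ∣
              ∑ j ∈ Finset.range (k + r), X ^ (ℓ * j) * s j) →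
          (∀ j ∈ T, s j = 0) → ∀ j < k + r, s j = 0) ↔
      (∀ i, 1 ≤ i → i ≤ k + r - 1 →
        ∀ c : F[X], c.degree < (p * τ : ℕ) → (1 + X ^ τ) * g ∣ c →
          ∃! s : F[X], (s.degree < (p * τ : ℕ) ∧ (1 + X ^ τ) * g ∣ s) ∧
            (1 + X ^ (p * τ) : F[X]) ∣ ((1 + X ^ i) * s - c))) := by
  have hn : 0 < p * τ := by omega
  have hAh : (1 + X ^ τ) * g * h = 1 + X ^ (p * τ) := by
    rw [mul_assoc, hgh, one_add_pow_mul_geom_sum]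
  have hcop : IsCoprime ((1 + X ^ τ) * g) h := hcop2.mul_left hcop1
  have hhdvd : h ∣ 1 + X ^ (p * τ) := ⟨_, by rw [← hAh, mul_comm]⟩
  have hX := isCoprime_X_pow_of_dvd_one_add_X_pow hn hhdvd
  constructor
  · intro hmds i hi hik c _ hcA
    have hinj : ∀ s : F[X], s.degree < (p * τ : ℕ) → (1 + X ^ τ) * g ∣ s →
        h ∣ (1 + X ^ i) * s → s = 0 := by
      intro s hsdeg hsA hsh
      have hM : 1 + X ^ (p * τ) ∣ (1 + X ^ i) * s := by
        rw [← hAh]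
        exact hcop.mul_dvd (hsA.mul_left _) hsh
      have hsub : ({0, i} : Finset ℕ) ⊆ Finset.range (k + r) := by
        intro j hj
        simp only [Finset.mem_insert, Finset.mem_singleton, Finset.mem_range] at hj ⊢
        omega
      have hcard : ({0, i} : Finset ℕ).card = 2 := Finset.card_pair (by omega)
      obtain ⟨T, hT, hTcard⟩ := Finset.exists_subset_card_eq
        (s := Finset.range (k + r) \ {0, i}) (n := k) (by
          rw [Finset.card_sdiff_of_subset hsub, hcard, Finset.card_range]
          omega)
      have h0 := hmds T (hT.trans Finset.sdiff_subset) hTcard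
        (fun j => if j ∈ ({0, i} : Finset ℕ) then s else 0) ?_ ?_ ?_ 0 (by omega)
      · simpa using h0
      · intro j _
        split_ifs
        · exact ⟨hsdeg, hsA⟩
        · exact ⟨degree_zero.trans_lt (WithBot.bot_lt_coe _), dvd_zero _⟩
      · intro ℓ _
        simp only [mul_ite, mul_zero]
        rw [Finset.sum_ite_mem, Finset.inter_eq_right.2 hsub, Finset.sum_pair (by omega),
          mul_zero, pow_zero, ← add_mul]
        exact hM.trans (mul_dvd_mul_right (one_add_dvd_one_add_pow_mul X i ℓ) s)
      · intro j hj
        exact if_neg (Finset.mem_sdiff.1 (hT hj)).2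
    obtain ⟨u, v, huv⟩ := isCoprime_of_forall_eq_zero hn hAh hcop hinj
    obtain ⟨s, hs, w, hw⟩ := exists_degree_lt_dvd_dvd_sub hn hAh hcop (u * c)
    have hsc : h ∣ (1 + X ^ i) * s - c :=
      ⟨(1 + X ^ i) * w - v * c, by linear_combination (1 + X ^ i) * hw + c * huv⟩
    refine ⟨s, ⟨hs, ?_⟩, ?_⟩
    · rw [← hAh]
      exact hcop.mul_dvd ((hs.2.mul_left _).sub hcA) hsc
    · rintro t ⟨ht, htc⟩
      refine sub_eq_zero.1 (hinj _ ((degree_sub_le _ _).trans_lt (max_lt ht.1 hs.1))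
        (ht.2.sub hs.2) ?_)
      have := (hhdvd.trans htc).sub hsc
      rwa [sub_sub_sub_cancel_right, ← mul_sub] at this
  · intro hbij T hT hTcard s hs hsum hzero
    have hcopi : ∀ i, 1 ≤ i → i ≤ k + r - 1 → IsCoprime (1 + X ^ i) h := by
      intro i hi hik
      obtain ⟨c, hc, w, hw⟩ := exists_degree_lt_dvd_dvd_sub hn hAh hcop 1
      obtain ⟨t, ⟨_, ht⟩, _⟩ := hbij i hi hik c hc.1 hc.2
      obtain ⟨v, hv⟩ := hhdvd.trans ht
      exact ⟨t, -(v + w), by linear_combination hv + hw⟩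
    intro j hj
    by_cases hjT : j ∈ T
    · exact hzero j hjT
    refine eq_zero_of_degree_lt_of_dvd hn hAh hcop (hs j hj).1 (hs j hj).2 ?_
    refine dvd_of_dvd_sum_pow_mul_of_isCoprime_sub (Finset.range (k + r) \ T)
      (fun j => X ^ j) s ?_ ?_ (Finset.mem_sdiff.2 ⟨Finset.mem_range.2 hj, hjT⟩)
    · intro a ha b hb hab
      exact isCoprime_X_pow_sub_X_pow_s4 hX hcopi (Finset.mem_range.1 (Finset.mem_sdiff.1 ha).1)
        (Finset.mem_range.1 (Finset.mem_sdiff.1 hb).1) hab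
    · intro ℓ hℓ
      rw [Finset.card_sdiff_of_subset hT, Finset.card_range, hTcard,
        Nat.add_sub_cancel_left] at hℓ
      have hdvd := hhdvd.trans (hsum ℓ hℓ)
      rw [← Finset.sum_sdiff hT, Finset.sum_eq_zero (s := T)
        (fun j hj => by rw [hzero j hj, mul_zero]), add_zero] at hdvd
      simpa only [← pow_mul, mul_comm] using hdvd
end

section
/- Let F be a field of characteristic 2, let p be an odd prime, let τ ≥ 1, and let k ≥ 1 and r ≥ 2 be integers with k + r = pτ. Then the code GEBR(p, τ, k, r, 1) is MDS (for every subset T ⊆ {0, …, k+r−1} with |T| = k, the only codeword vanishing on all columns in T is zero) if and only if τ = p^ν for some non-negative integer ν. -/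
open Polynomial

/-- If `p` is invertible and `d` is not divisible by the prime power `p ^ (n + 1)`, then
`X ^ d - 1` is coprime to `1 + X ^ (p ^ n) + ⋯ + X ^ ((p - 1) p ^ n)`. -/
theorem isCoprime_X_pow_sub_one_geom_sum {F : Type*} [Field F] {p d n : ℕ} (hp : p.Prime)
    (hpF : (p : F) ≠ 0) (hd : ¬ p ^ (n + 1) ∣ d) :
    IsCoprime (X ^ d - 1 : F[X]) (∑ i ∈ Finset.range p, (X ^ p ^ n) ^ i) := by
  refine isCoprime_of_prime_dvd ?_ ?_
  · rintro ⟨h, -⟩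
    have hd0 : 0 < d := Nat.pos_of_ne_zero (by rintro rfl; simp at hd)
    exact X_pow_sub_C_ne_zero hd0 (1 : F) (by simpa using h)
  · intro q hq h1 h2
    have h3 : q ∣ (X ^ p ^ n) ^ p - 1 := by
      rw [← geom_sum_mul]
      exact h2.mul_right _
    rw [← Ideal.mem_span_singleton, ← Ideal.Quotient.eq_zero_iff_mem] at h1 h3
    have h4 := h2
    rw [← Ideal.mem_span_singleton, ← Ideal.Quotient.eq_zero_iff_mem] at h4
    simp only [map_sub, map_pow, map_one, map_sum, sub_eq_zero, ← pow_mul, ← pow_succ]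
      at h1 h3 h4
    set x := Ideal.Quotient.mk (Ideal.span {q}) (X : F[X])
    have hx : x ^ p ^ n = 1 := by
      rw [← orderOf_dvd_iff_pow_eq_one] at h1 h3 ⊢
      obtain ⟨m, hm, e⟩ := (Nat.dvd_prime_pow hp).1 h3
      rw [e] at h1 ⊢
      refine pow_dvd_pow _ (Nat.le_of_lt_succ (lt_of_le_of_ne hm ?_))
      rintro rfl
      exact hd h1
    have h5 : Ideal.Quotient.mk (Ideal.span {q}) (C (p : F)) = 0 := by
      simpa [pow_mul, hx] using h4
    rw [Ideal.Quotient.eq_zero_iff_mem, Ideal.mem_span_singleton] at h5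
    exact hq.not_isUnit (isUnit_of_dvd_unit h5 (isUnit_C.2 hpF.isUnit))

/-- If `a` divides every entry of `Mᵀ *ᵥ s`, where `M` is the Vandermonde matrix of `v`, then `a`
divides every `det M * s i`. -/
theorem dvd_det_vandermonde_mul {R : Type*} [CommRing R] {r : ℕ} (v s : Fin r → R) (a : R)
    (h : ∀ l : Fin r, a ∣ ∑ i, v i ^ (l : ℕ) * s i) (i : Fin r) :
    a ∣ (Matrix.vandermonde v).det * s i := by
  have e := congrFun (Matrix.mulVec_mulVec s (Matrix.vandermonde v).transpose.adjugate
    (Matrix.vandermonde v).transpose) i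
  rw [Matrix.adjugate_mul, Matrix.smul_mulVec, Matrix.one_mulVec, Matrix.det_transpose,
    Pi.smul_apply, smul_eq_mul] at e
  rw [← e]
  have hM : ∀ l, a ∣ ((Matrix.vandermonde v).transpose.mulVec s) l := fun l => by
    simpa [Matrix.mulVec, dotProduct, Matrix.vandermonde_apply] using h l
  rw [Matrix.mulVec, dotProduct]
  exact Finset.dvd_sum fun l _ => (hM l).mul_left _

theorem stmt_7 (F : Type*) [Field F] [CharP F 2]
    (p τ k r : ℕ) (hp : p.Prime) (hodd : p ≠ 2) (hτ : 1 ≤ τ)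
    (hk : 1 ≤ k) (hr : 2 ≤ r) (hkr : k + r = p * τ) :
    ((∀ T : Finset ℕ, T ⊆ Finset.range (k + r) → T.card = k →
        ∀ s : ℕ → F[X],
          (∀ j < k + r, (s j).degree < (p * τ : ℕ) ∧ (1 + X ^ τ : F[X]) ∣ s j) →
          (∀ ℓ < r, (1 + X ^ (p * τ) : F[X]) ∣
              ∑ j ∈ Finset.range (k + r), X ^ (ℓ * j) * s j) →
          (∀ j ∈ T, s j = 0) → ∀ j < k + r, s j = 0) ↔
      ∃ ν : ℕ, τ = p ^ ν) := by
  have hsub : ∀ a : ℕ, (1 + X ^ a : F[X]) = X ^ a - 1 := fun a => by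
    rw [CharTwo.sub_eq_add, add_comm]
  simp only [hsub]
  have hpτ : 0 < p * τ := Nat.mul_pos hp.pos hτ
  have hdeg : (X ^ (p * τ) - 1 : F[X]).degree = (p * τ : ℕ) := by
    simpa using degree_X_pow_sub_C hpτ (1 : F)
  constructor
  · intro H
    by_contra hne
    obtain ⟨ν, m, hm, rfl⟩ := Nat.exists_eq_pow_mul_and_not_dvd (n := τ) (by lia) p hp.ne_one
    have hm1 : 1 < m := by
      rcases m with _ | _ | m
      · simp at hm
      · exact absurd ⟨ν, by simp⟩ hne
      · lia
    set d := p ^ (ν + 1) with hd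
    have hd0 : 0 < d := pow_pos hp.pos _
    have hdm : p * (p ^ ν * m) = d * m := by rw [hd]; ring
    have hdlt : d < k + r := by rw [hkr, hdm]; nlinarith
    obtain ⟨b, hb⟩ : cyclotomic d F ∣
        ∏ x ∈ (p * (p ^ ν * m)).divisors \ (p ^ ν * m).divisors, cyclotomic x F := by
      refine Finset.dvd_prod_of_mem (fun x => cyclotomic x F) ?_
      simp only [Finset.mem_sdiff, Nat.mem_divisors, not_and_or]
      refine ⟨⟨⟨m, hdm⟩, hpτ.ne'⟩, Or.inl fun h => hm ?_⟩
      rw [hd, pow_succ] at h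
      exact Nat.dvd_of_mul_dvd_mul_left (pow_pos hp.pos ν) h
    have hfac := X_pow_sub_one_mul_prod_cyclotomic_eq_X_pow_sub_one_of_dvd F
      (Dvd.intro_left p rfl : p ^ ν * m ∣ p * (p ^ ν * m)) hpτ.ne'
    rw [hb] at hfac
    set c : F[X] := (X ^ (p ^ ν * m) - 1) * b with hc
    have hcc : X ^ (p * (p ^ ν * m)) - 1 = cyclotomic d F * c := by
      rw [← hfac, hc]; ring
    have hc0 : c ≠ 0 := by
      intro h
      rw [hcc, h, mul_zero, degree_zero] at hdeg
      exact WithBot.bot_ne_coe hdeg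
    have hcdeg : c.degree < (p * (p ^ ν * m) : ℕ) := by
      rw [← hdeg, hcc, mul_comm, degree_mul (p := c), degree_eq_natDegree hc0, degree_cyclotomic]
      have := Nat.totient_pos.2 hd0
      exact_mod_cast Nat.lt_add_of_pos_right this
    obtain ⟨T, hT, hTk⟩ := Finset.exists_subset_card_eq
      (s := (Finset.range (k + r)) \ {0, d}) (n := k) (by
        have := Finset.le_card_sdiff {0, d} (Finset.range (k + r))
        have := Finset.card_le_two (a := 0) (b := d)
        rw [Finset.card_range] at *
        lia)
    refine hc0 ?_
    have := H T (hT.trans Finset.sdiff_subset) hTk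
      (fun j => if j ∈ ({0, d} : Finset ℕ) then c else 0)
      ?_ ?_ ?_ 0 (by lia)
    · simpa using this
    · intro j _
      split_ifs
      · exact ⟨hcdeg, Dvd.intro _ rfl⟩
      · simp only [degree_zero, dvd_zero, and_true]
        exact WithBot.bot_lt_coe _
    · intro l _
      have hss : ({0, d} : Finset ℕ) ⊆ Finset.range (k + r) := by
        intro j
        simp only [Finset.mem_insert, Finset.mem_singleton, Finset.mem_range]
        lia
      simp only [mul_ite, mul_zero]
      rw [Finset.sum_ite_mem, Finset.inter_eq_right.2 hss, Finset.sum_pair hd0.ne, ← add_mul,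
        mul_zero, pow_zero, hsub, hcc]
      refine mul_dvd_mul_right ((cyclotomic.dvd_X_pow_sub_one d F).trans ?_) _
      rw [mul_comm, pow_mul]
      exact sub_one_dvd_pow_sub_one _ l
    · intro j hj
      exact if_neg (Finset.mem_sdiff.1 (hT hj)).2
  · rintro ⟨ν, rfl⟩ T hT hTk s hs hsum hzero
    have hpF : (p : F) ≠ 0 := by
      rw [Ne, CharP.cast_eq_zero_iff F 2, Nat.prime_dvd_prime_iff_eq Nat.prime_two hp]
      exact hodd.symm
    set Φ : F[X] := ∑ i ∈ Finset.range p, (X ^ p ^ ν) ^ i with hΦ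
    have hfac : (X ^ (p * p ^ ν) - 1 : F[X]) = Φ * (X ^ p ^ ν - 1) := by
      rw [hΦ, geom_sum_mul, ← pow_mul, mul_comm p]
    have hXΦ : IsCoprime (X : F[X]) Φ := by
      refine IsCoprime.of_isCoprime_of_dvd_right (y := X ^ (p * p ^ ν) - 1) ?_ ⟨_, hfac⟩
      refine ⟨X ^ (p * p ^ ν - 1), -1, ?_⟩
      rw [← pow_succ, Nat.sub_add_cancel hpτ]
      ring
    have hJ : (Finset.range (k + r) \ T).card = r := by
      rw [Finset.card_sdiff_of_subset hT, Finset.card_range]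
      lia
    set v := (Finset.range (k + r) \ T).orderEmbOfFin hJ with hv
    have hlt : ∀ i, v i < k + r := fun i =>
      Finset.mem_range.1 (Finset.mem_sdiff.1 (Finset.orderEmbOfFin_mem _ hJ i)).1
    have hdet : IsCoprime Φ (Matrix.vandermonde fun i => (X ^ v i : F[X])).det := by
      rw [Matrix.det_vandermonde]
      refine IsCoprime.prod_right fun i _ => IsCoprime.prod_right fun j hj => ?_
      have hij : v i < v j := v.strictMono (Finset.mem_Ioi.1 hj)
      have : (X ^ v j - X ^ v i : F[X]) = X ^ v i * (X ^ (v j - v i) - 1) := by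
        rw [mul_sub, ← pow_add, Nat.add_sub_cancel' hij.le, mul_one]
      rw [this]
      refine IsCoprime.symm (IsCoprime.mul_left hXΦ.pow_left
        (isCoprime_X_pow_sub_one_geom_sum hp hpF fun h => ?_))
      have h1 := Nat.le_of_dvd (Nat.sub_pos_of_lt hij) h
      have h2 := hlt j
      rw [pow_succ, mul_comm] at h1
      lia
    have hvan := dvd_det_vandermonde_mul (fun i => (X ^ v i : F[X])) (fun i => s (v i))
      (X ^ (p * p ^ ν) - 1) fun l => by
        convert hsum l l.2 using 1
        rw [← Finset.sum_sdiff hT, Finset.sum_eq_zero (s := T) fun j hj => by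
            rw [hzero j hj, mul_zero], add_zero, ← Finset.image_orderEmbOfFin_univ _ hJ,
          Finset.sum_image fun a _ b _ h => v.injective h]
        exact Finset.sum_congr rfl fun i _ => by rw [← pow_mul, mul_comm (v i)]
    intro j hj
    by_cases hjT : j ∈ T
    · exact hzero j hjT
    obtain ⟨i, rfl⟩ : j ∈ Set.range v := by
      rw [hv, Finset.range_orderEmbOfFin]
      simp [hjT, hj]
    obtain ⟨hdegs, t, ht⟩ := hs _ hj
    refine eq_zero_of_dvd_of_degree_lt (p := X ^ (p * p ^ ν) - 1) ?_ (hdeg ▸ hdegs)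
    have h := hvan i
    have h0 : (X ^ p ^ ν - 1 : F[X]) ≠ 0 := by
      simpa using X_pow_sub_C_ne_zero hτ (1 : F)
    simp only [ht] at h ⊢
    rw [hfac] at h ⊢
    rw [mul_left_comm, mul_comm Φ, mul_dvd_mul_iff_left h0] at h
    rw [mul_comm Φ, mul_dvd_mul_iff_left h0]
    exact hdet.dvd_of_dvd_mul_left h
end

section
/- Let F be a field of characteristic 2, let p be an odd prime, let τ be a positive integer, and let g ∈ F[x] divide 1 + x^τ + ⋯ + x^{(p−1)τ} with g coprime to 1 + x^τ. Let b be an integer with 1 ≤ b < pτ and gcd(b, p) = 1, and set a = gcd(b, τ). Let f ∈ F[x] with deg f < pτ and (1 + x^τ)·g ∣ f, and let r ∈ F[x] with deg r < pτ, (1 + x^τ) ∣ r, and (1 + x^{pτ}) ∣ ((1 + x^b)·r − f). Writing f_n and r_n for the coefficients of x^n (all indices taken modulo pτ), the following hold: (1) for every j ∈ {0, …, a−1}, r_j = Σ_{u=1}^{(p−1)/2} Σ_{ℓ=1}^{τ} f_{((2u−1)τb + ℓb + j) mod pτ}; (2) for every j ∈ {0, …, a−1} and every ℓ ∈ {1,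 …, pτ/a − 1}, r_{(bℓ+j) mod pτ} = f_{(bℓ+j) mod pτ} + r_{(b(ℓ−1)+j) mod pτ}; and (3) (1 + x^τ)·g divides r. -/
open Polynomial

/-- The sum of the coefficients of `q` over the exponents in the residue class `c` modulo `M`. -/
noncomputable def residueCoeff (F : Type*) [Field F] (M : ℕ) (c : ZMod M) : F[X] →ₗ[F] F :=
  Polynomial.lsum fun n => if (n : ZMod M) = c then LinearMap.id else 0

section ResidueCoeff

variable {F : Type*} [Field F]

theorem residueCoeff_monomial (M : ℕ) (c : ZMod M) (n : ℕ) (x : F) :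
    residueCoeff F M c (monomial n x) = if (n : ZMod M) = c then x else 0 := by
  rw [residueCoeff, Polynomial.lsum_apply, Polynomial.sum_monomial_index]
  · split_ifs <;> simp
  · simp

theorem residueCoeff_X_pow_mul (M b : ℕ) (c : ZMod M) (q : F[X]) :
    residueCoeff F M (c + b) (X ^ b * q) = residueCoeff F M c q := by
  induction q using Polynomial.induction_on' with
  | add p q hp hq => rw [mul_add, map_add, map_add, hp, hq]
  | monomial n x =>
    rw [X_pow_mul_monomial, residueCoeff_monomial, residueCoeff_monomial]
    simp

theorem residueCoeff_of_degree_lt (M N : ℕ) (c : ZMod M) (q : F[X]) (hq : q.degree < N) :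
    residueCoeff F M c q =
      ∑ m ∈ Finset.range N with ((m : ℕ) : ZMod M) = c, q.coeff m := by
  obtain rfl | h := eq_or_ne q 0
  · simp
  nth_rewrite 1 [q.as_sum_range' N ((natDegree_lt_iff_degree_lt h).2 hq)]
  rw [map_sum, Finset.sum_filter]
  exact Finset.sum_congr rfl fun m _ => residueCoeff_monomial M c m _

theorem residueCoeff_self_of_degree_lt (N n : ℕ) (hN : 0 < N) (q : F[X]) (hq : q.degree < N) :
    residueCoeff F N n q = q.coeff (n % N) := by
  rw [residueCoeff_of_degree_lt N N n q hq]
  rw [Finset.sum_eq_single_of_mem (n % N)]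
  · simp [Nat.mod_lt n hN]
  · intro m hm hne
    rw [Finset.mem_filter, Finset.mem_range, ZMod.natCast_eq_natCast_iff'] at hm
    exact absurd (by rw [← hm.2, Nat.mod_eq_of_lt hm.1]) hne

theorem residueCoeff_eq_zero_of_dvd [CharP F 2] (M : ℕ) (c : ZMod M) (q : F[X])
    (h : (1 + X ^ M : F[X]) ∣ q) : residueCoeff F M c q = 0 := by
  obtain ⟨s, rfl⟩ := h
  have := residueCoeff_X_pow_mul M M c s
  rw [CharP.cast_eq_zero, add_zero] at this
  rw [add_mul, one_mul, map_add, this, CharTwo.add_self_eq_zero]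

theorem coeff_add_mod_of_dvd [CharP F 2] (N b : ℕ) (hN : 0 < N) (f r : F[X])
    (hf : f.degree < N) (hr : r.degree < N)
    (h : (1 + X ^ N : F[X]) ∣ (1 + X ^ b) * r - f) (n : ℕ) :
    f.coeff ((n + b) % N) = r.coeff ((n + b) % N) + r.coeff (n % N) := by
  have h0 := residueCoeff_eq_zero_of_dvd N ((n + b : ℕ) : ZMod N) _ h
  rw [map_sub, sub_eq_zero, add_mul, one_mul, map_add] at h0
  rw [← residueCoeff_self_of_degree_lt N _ hN f hf, ← h0,
    ← residueCoeff_self_of_degree_lt N _ hN r hr, ← residueCoeff_self_of_degree_lt N _ hN r hr,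
    Nat.cast_add, residueCoeff_X_pow_mul]

theorem sum_coeff_mod_eq_zero [CharP F 2] (p τ b j : ℕ) (hp : 0 < p) (hτ : 0 < τ) (hj : j < τ)
    (hbp : b.Coprime p) (r : F[X]) (hr : r.degree < (p * τ : ℕ))
    (h : (1 + X ^ τ : F[X]) ∣ r) :
    ∑ k ∈ Finset.range p, r.coeff ((k * τ * b + j) % (p * τ)) = 0 := by
  rw [← residueCoeff_eq_zero_of_dvd τ (j : ZMod τ) r h, residueCoeff_of_degree_lt τ _ _ r hr]
  refine Finset.sum_nbij (fun k => (k * τ * b + j) % (p * τ)) ?_ ?_ ?_ fun _ _ => rfl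
  · intro k _
    rw [Finset.mem_filter, Finset.mem_range, ZMod.natCast_eq_natCast_iff']
    refine ⟨Nat.mod_lt _ (by positivity), ?_⟩
    rw [Nat.mod_mul_left_mod, show k * τ * b + j = j + τ * (k * b) by ring,
      Nat.add_mul_mod_self_left]
  · intro k hk l hl hkl
    have h1 : k * τ * b + j ≡ l * τ * b + j [MOD p * τ] := hkl
    have h2 := Nat.ModEq.add_right_cancel' j h1
    rw [mul_right_comm k, mul_right_comm l] at h2
    have h3 := Nat.ModEq.mul_right_cancel' hτ.ne' h2
    have h4 := Nat.ModEq.cancel_right_of_coprime (Nat.Coprime.symm hbp) h3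
    exact h4.eq_of_lt_of_lt (Finset.mem_range.1 hk) (Finset.mem_range.1 hl)
  · intro m hm
    rw [Finset.mem_coe, Finset.mem_filter, Finset.mem_range, ZMod.natCast_eq_natCast_iff',
      Nat.mod_eq_of_lt hj] at hm
    obtain ⟨c, hcp, hc⟩ := Nat.exists_mul_mod_eq_of_coprime (m / τ) hbp hp.ne'
    refine ⟨c, by simpa using hcp, ?_⟩
    have h1 : c * b ≡ m / τ [MOD p] := by rwa [mul_comm]
    have h2 := (h1.mul_right' τ).add_right j
    have h3 : m / τ * τ + j = m := by
      conv_rhs => rw [← Nat.div_add_mod' m τ, hm.2]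
    rw [h3, mul_right_comm] at h2
    exact Eq.trans h2 (Nat.mod_eq_of_lt hm.1)

end ResidueCoeff

theorem sum_range_two_mul_add_one {M : Type*} [AddCommMonoid M] (A : ℕ → M) (h : ℕ) :
    ∑ k ∈ Finset.range (2 * h + 1), A k =
      A 0 + ∑ u ∈ Finset.Icc 1 h, (A (2 * u - 1) + A (2 * u)) := by
  induction h with
  | zero => simp
  | succ h ih =>
    rw [Finset.sum_Icc_succ_top (by omega), ← add_assoc, ← ih,
      show 2 * (h + 1) + 1 = 2 * h + 1 + 1 + 1 by ring, Finset.sum_range_succ,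
      Finset.sum_range_succ, add_assoc]
    rfl

theorem sum_Icc_add_eq_of_charTwo {F : Type*} [Field F] [CharP F 2] (A : ℕ → F) (n : ℕ) :
    ∑ l ∈ Finset.Icc 1 n, (A l + A (l - 1)) = A 0 + A n := by
  induction n with
  | zero => simp [CharTwo.add_self_eq_zero]
  | succ n ih =>
    rw [Finset.sum_Icc_succ_top (by omega), ih, Nat.add_sub_cancel, add_add_add_comm,
      add_comm (A n), ← add_assoc, add_assoc, CharTwo.add_self_eq_zero, add_zero]

theorem dvd_one_add_X_pow_gcd {F : Type*} [Field F] [CharP F 2] (m n : ℕ) (z : F[X])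
    (hm : z ∣ 1 + X ^ m) (hn : z ∣ 1 + X ^ n) : z ∣ 1 + X ^ m.gcd n := by
  have key (k : ℕ) : z ∣ 1 + X ^ k ↔ (Ideal.Quotient.mk (Ideal.span {z}) X) ^ k = 1 := by
    rw [← map_pow, ← map_one (Ideal.Quotient.mk (Ideal.span {z})),
      Ideal.Quotient.mk_eq_mk_iff_sub_mem, Ideal.mem_span_singleton, CharTwo.sub_eq_add, add_comm]
  rw [key] at *
  exact pow_gcd_eq_one.2 ⟨hm, hn⟩

theorem one_add_X_pow_dvd {F : Type*} [Field F] [CharP F 2] {m n : ℕ} (h : m ∣ n) :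
    (1 + X ^ m : F[X]) ∣ 1 + X ^ n := by
  obtain ⟨k, rfl⟩ := h
  have := sub_dvd_pow_sub_pow (X ^ m : F[X]) 1 k
  rwa [one_pow, ← pow_mul, CharTwo.sub_eq_add, CharTwo.sub_eq_add, add_comm,
    add_comm (X ^ (m * k))] at this

theorem geom_sum_X_pow_dvd {F : Type*} [Field F] [CharP F 2] (p τ : ℕ) :
    ∑ n ∈ Finset.range p, (X : F[X]) ^ (n * τ) ∣ 1 + X ^ (p * τ) := by
  refine ⟨X ^ τ - 1, ?_⟩
  simp only [mul_comm _ τ, pow_mul]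
  rw [geom_sum_mul, CharTwo.sub_eq_add, add_comm]

theorem stmt_9 (F : Type*) [Field F] [CharP F 2]
    (p τ : ℕ) (hp : p.Prime) (hodd : p ≠ 2) (hτ : 1 ≤ τ)
    (g : F[X]) (hg : g ∣ ∑ n ∈ Finset.range p, (X : F[X]) ^ (n * τ))
    (hgcop : IsCoprime g (1 + X ^ τ))
    (b a : ℕ) (hb1 : 1 ≤ b) (hb2 : b < p * τ) (hbp : Nat.gcd b p = 1)
    (ha : a = Nat.gcd b τ)
    (f : F[X]) (hfdeg : f.degree < (p * τ : ℕ)) (hfdvd : (1 + X ^ τ) * g ∣ f)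
    (r : F[X]) (hrdeg : r.degree < (p * τ : ℕ)) (hrdvd : (1 + X ^ τ : F[X]) ∣ r)
    (hdiv : (1 + X ^ (p * τ) : F[X]) ∣ ((1 + X ^ b) * r - f)) :
    (∀ j < a, r.coeff j =
        ∑ u ∈ Finset.Icc 1 ((p - 1) / 2), ∑ ℓ ∈ Finset.Icc 1 τ,
          f.coeff (((2 * u - 1) * τ * b + ℓ * b + j) % (p * τ))) ∧
    (∀ j < a, ∀ ℓ, 1 ≤ ℓ → ℓ ≤ p * τ / a - 1 →
        r.coeff ((b * ℓ + j) % (p * τ)) =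
          f.coeff ((b * ℓ + j) % (p * τ)) +
            r.coeff ((b * (ℓ - 1) + j) % (p * τ))) ∧
    ((1 + X ^ τ) * g ∣ r) := by
  have hN : 0 < p * τ := Nat.mul_pos hp.pos hτ
  have hrec := coeff_add_mod_of_dvd (p * τ) b hN f r hfdeg hrdeg hdiv
  refine ⟨fun j hj => ?_, fun j _ ℓ hℓ _ => ?_, ?_⟩
  · have hjτ : j < τ := hj.trans_le (ha ▸ Nat.gcd_le_right b hτ)
    have hodd' : 2 * ((p - 1) / 2) + 1 = p := by
      have := hp.eq_two_or_odd
      omega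
    have hsum := sum_coeff_mod_eq_zero p τ b j hp.pos hτ hjτ hbp r hrdeg hrdvd
    rw [← hodd', sum_range_two_mul_add_one, hodd', CharTwo.add_eq_zero, zero_mul, zero_mul,
      zero_add, Nat.mod_eq_of_lt (hjτ.trans_le (Nat.le_mul_of_pos_left τ hp.pos))] at hsum
    rw [hsum]
    refine Finset.sum_congr rfl fun u hu => ?_
    have hu1 : 2 * u = 2 * u - 1 + 1 := by
      have := (Finset.mem_Icc.1 hu).1
      omega
    have htel := sum_Icc_add_eq_of_charTwo
      (fun l => r.coeff (((2 * u - 1) * τ * b + l * b + j) % (p * τ))) τ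
    have hend : (2 * u - 1) * τ * b + τ * b + j = 2 * u * τ * b + j := by
      conv_rhs => rw [hu1]
      ring
    simp only [zero_mul, add_zero, hend] at htel
    rw [← htel]
    refine Finset.sum_congr rfl fun l hl => ?_
    obtain ⟨l, rfl⟩ := Nat.exists_eq_add_of_le' (Finset.mem_Icc.1 hl).1
    have := hrec ((2 * u - 1) * τ * b + l * b + j)
    rw [show (2 * u - 1) * τ * b + l * b + j + b = (2 * u - 1) * τ * b + (l + 1) * b + j by ring]
      at this
    rw [this, Nat.add_sub_cancel]
  · obtain ⟨l, rfl⟩ := Nat.exists_eq_add_of_le' hℓ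
    have := hrec (b * l + j)
    rw [show b * l + j + b = b * (l + 1) + j by ring] at this
    rw [this, Nat.add_sub_cancel, add_assoc, CharTwo.add_self_eq_zero, add_zero]
  · have hgN : g ∣ 1 + X ^ (p * τ) := hg.trans (geom_sum_X_pow_dvd p τ)
    have hgb : IsCoprime g (1 + X ^ b) := by
      refine EuclideanDomain.isCoprime_of_dvd ?_ ?_
      · rintro ⟨rfl, -⟩
        have h0 := zero_dvd_iff.1 hgN
        have := congrArg (fun q : F[X] => q.coeff 0) h0
        simp [coeff_X_pow, hN.ne] at this
      · intro z hz _ hzg hzb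
        have h1 := dvd_one_add_X_pow_gcd b (p * τ) z hzb (hzg.trans hgN)
        rw [Nat.Coprime.gcd_mul_left_cancel_right τ (Nat.Coprime.symm hbp)] at h1
        exact hz (hgcop.isUnit_of_dvd' hzg (h1.trans (one_add_X_pow_dvd (Nat.gcd_dvd_right b τ))))
    have hgf : g ∣ (1 + X ^ b) * r :=
      (dvd_sub_left ((dvd_mul_left g _).trans hfdvd)).1 (hgN.trans hdiv)
    exact hgcop.symm.mul_dvd hrdvd (hgb.dvd_of_dvd_mul_left hgf)
end

section
/- Let F be a field of characteristic 2, p an odd prime, τ ≥ 1, let g ∈ F[x] divide 1 + x^τ + ⋯ + x^{(p−1)τ} with g coprime to 1 + x^τ, let k, r ≥ 1 with k + r ≤ pτ, and let P be a k×r matrix of polynomials P_{j,i} ∈ F[x]. Consider the array code whose codewords are the vectors (s_0, …, s_{k+r−1}) with every s_j ∈ C_{pτ}(g) and (1 + x^{pτ}) ∣ (s_{k+i} − Σ_{j=0}^{k−1} P_{j,i}·s_j) for every i ∈ {0, …, r−1}. Assume the code is MDS (for every subset T of {0, …, k+r−1} with |T| = k, the only codeword vanishing on all columns in T is zero), and let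 d ≥ 1 be such that every nonzero element of C_{pτ}(g) has at least d nonzero coefficients. Then every nonzero codeword has symbol weight at least d·(r+1). -/
open Polynomial

theorem stmt_11 (F : Type*) [Field F] [CharP F 2]
    (p τ k r d : ℕ) (hp : p.Prime) (hodd : p ≠ 2) (hτ : 1 ≤ τ)
    (g : F[X]) (hg : g ∣ ∑ n ∈ Finset.range p, (X : F[X]) ^ (n * τ))
    (hgcop : IsCoprime g (1 + X ^ τ))
    (hk : 1 ≤ k) (hr : 1 ≤ r) (hkr : k + r ≤ p * τ)
    (P : ℕ → ℕ → F[X])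
    (hmds : ∀ T : Finset ℕ, T ⊆ Finset.range (k + r) → T.card = k →
      ∀ s : ℕ → F[X],
        (∀ j < k + r, (s j).degree < (p * τ : ℕ) ∧ (1 + X ^ τ) * g ∣ s j) →
        (∀ i < r, (1 + X ^ (p * τ) : F[X]) ∣
            (s (k + i) - ∑ j ∈ Finset.range k, P j i * s j)) →
        (∀ j ∈ T, s j = 0) → ∀ j < k + r, s j = 0)
    (hd : 1 ≤ d)
    (hdmin : ∀ c : F[X], c.degree < (p * τ : ℕ) → (1 + X ^ τ) * g ∣ c → c ≠ 0 →
      d ≤ c.support.card) :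
    ∀ s : ℕ → F[X],
      (∀ j < k + r, (s j).degree < (p * τ : ℕ) ∧ (1 + X ^ τ) * g ∣ s j) →
      (∀ i < r, (1 + X ^ (p * τ) : F[X]) ∣
          (s (k + i) - ∑ j ∈ Finset.range k, P j i * s j)) →
      (∃ j < k + r, s j ≠ 0) →
      d * (r + 1) ≤ ∑ j ∈ Finset.range (k + r), (s j).support.card := by
  classical
  intro s hs hpar hne
  set Z := (Finset.range (k + r)).filter fun j => s j = 0 with hZ
  set N := (Finset.range (k + r)).filter fun j => ¬ s j = 0 with hN
  have hZk : Z.card < k := by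
    by_contra! hle
    obtain ⟨T, hTZ, hT⟩ := Finset.exists_subset_card_eq hle
    obtain ⟨j, hj, hsj⟩ := hne
    exact hsj (hmds T (hTZ.trans (Finset.filter_subset _ _)) hT s hs hpar
      (fun i hi => (Finset.mem_filter.mp (hTZ hi)).2) j hj)
  have hcard : Z.card + N.card = k + r := by
    rw [hZ, hN, Finset.card_filter_add_card_filter_not, Finset.card_range]
  calc d * (r + 1) ≤ d * N.card := Nat.mul_le_mul_left d (by omega)
    _ = N.card • d := by rw [smul_eq_mul, mul_comm]
    _ ≤ ∑ j ∈ N, (s j).support.card := Finset.card_nsmul_le_sum _ _ _ fun j hj => by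
        obtain ⟨hj, hsj⟩ := Finset.mem_filter.mp hj
        obtain ⟨hdeg, hdvd⟩ := hs j (Finset.mem_range.mp hj)
        exact hdmin (s j) hdeg hdvd hsj
    _ ≤ ∑ j ∈ Finset.range (k + r), (s j).support.card :=
        Finset.sum_le_sum_of_subset (Finset.filter_subset _ _)
end

section
/- Let F be a field of characteristic 2, p an odd prime, τ ≥ 1, let g ∈ F[x] divide 1 + x^τ + ⋯ + x^{(p−1)τ} with g coprime to 1 + x^τ, let k, r ≥ 1 with k + r ≤ pτ, and let P be a k×r matrix each of whose entries is a power of x, i.e., P_{j,i} = x^{e(j,i)} for non-negative integers e(j,i). Consider the array code whose codewords are the vectors (s_0, …, s_{k+r−1}) with every s_j ∈ C_{pτ}(g) and (1 + x^{pτ}) ∣ (s_{k+i} − Σ_{j=0}^{k−1} P_{j,i}·s_j) for every i ∈ {0, …, r−1}. Assume the code is MDS (every codeword vanishing on some set of k columns is zero, for every such set), and let d ≥ 1 be such that every nonzero element of C_{pτ}(g) has at least d nonzero coefficients and some nonzero element of C_{pτ}(g) has exactly d nonzero coefficients. Then the minimum symbol distance of the code equals d·(r+1): every nonzero codeword has symbol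 weight at least d·(r+1), and some nonzero codeword has symbol weight exactly d·(r+1). -/
open Polynomial

theorem exists_cyclic_shift {F : Type*} [Field F] [CharP F 2] {n : ℕ} (hn : 0 < n) (m : ℕ)
    (c : F[X]) :
    ∃ t : F[X], t.degree < (n : ℕ) ∧ (1 + X ^ n : F[X]) ∣ t - X ^ m * c ∧
      t.support.card ≤ c.support.card := by
  refine ⟨∑ i ∈ c.support, monomial ((i + m) % n) (c.coeff i), ?_, ?_, ?_⟩
  · rw [← mem_degreeLT]
    refine Submodule.sum_mem _ fun i _ => mem_degreeLT.2 ?_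
    exact (degree_monomial_le _ _).trans_lt (by exact_mod_cast Nat.mod_lt _ hn)
  · have h : X ^ m * c = ∑ i ∈ c.support, monomial (i + m) (c.coeff i) := by
      conv_lhs => rw [c.as_sum_support]
      rw [Finset.mul_sum]
      exact Finset.sum_congr rfl fun i _ => by rw [X_pow_mul, monomial_mul_X_pow]
    rw [h, ← Finset.sum_sub_distrib]
    refine Finset.dvd_sum fun i _ => ?_
    have hpow : (1 + X ^ n : F[X]) ∣ (X ^ n) ^ ((i + m) / n) - 1 := by
      have h1 : (1 + X ^ n : F[X]) = X ^ n - 1 := by rw [CharTwo.sub_eq_add, add_comm]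
      rw [h1]
      simpa using sub_dvd_pow_sub_pow ((X : F[X]) ^ n) 1 ((i + m) / n)
    have hsplit : monomial ((i + m) % n) (c.coeff i) - monomial (i + m) (c.coeff i) =
        -(monomial ((i + m) % n) (c.coeff i)) * ((X ^ n) ^ ((i + m) / n) - 1) := by
      rw [← pow_mul, neg_mul, mul_sub, monomial_mul_X_pow, Nat.mod_add_div]
      ring
    rw [hsplit]
    exact hpow.mul_left _
  · refine (Finset.card_le_card (t := c.support.image fun i => (i + m) % n) ?_).trans
      Finset.card_image_le
    intro j hj
    by_contra hj'
    rw [mem_support_iff, finsetSum_coeff] at hj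
    refine hj (Finset.sum_eq_zero fun i hi => coeff_monomial_of_ne _ ?_)
    rintro rfl
    exact hj' (Finset.mem_image_of_mem _ hi)

theorem stmt_12 (F : Type*) [Field F] [CharP F 2]
    (p τ k r d : ℕ) (hp : p.Prime) (hodd : p ≠ 2) (hτ : 1 ≤ τ)
    (g : F[X]) (hg : g ∣ ∑ n ∈ Finset.range p, (X : F[X]) ^ (n * τ))
    (hgcop : IsCoprime g (1 + X ^ τ))
    (hk : 1 ≤ k) (hr : 1 ≤ r) (hkr : k + r ≤ p * τ)
    (e : ℕ → ℕ → ℕ)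
    (hmds : ∀ T : Finset ℕ, T ⊆ Finset.range (k + r) → T.card = k →
      ∀ s : ℕ → F[X],
        (∀ j < k + r, (s j).degree < (p * τ : ℕ) ∧ (1 + X ^ τ) * g ∣ s j) →
        (∀ i < r, (1 + X ^ (p * τ) : F[X]) ∣
            (s (k + i) - ∑ j ∈ Finset.range k, X ^ (e j i) * s j)) →
        (∀ j ∈ T, s j = 0) → ∀ j < k + r, s j = 0)
    (hd : 1 ≤ d)
    (hdmin : ∀ c : F[X], c.degree < (p * τ : ℕ) → (1 + X ^ τ) * g ∣ c → c ≠ 0 →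
      d ≤ c.support.card)
    (hdex : ∃ c : F[X], c.degree < (p * τ : ℕ) ∧ (1 + X ^ τ) * g ∣ c ∧ c ≠ 0 ∧
      c.support.card = d) :
    (∀ s : ℕ → F[X],
      (∀ j < k + r, (s j).degree < (p * τ : ℕ) ∧ (1 + X ^ τ) * g ∣ s j) →
      (∀ i < r, (1 + X ^ (p * τ) : F[X]) ∣
          (s (k + i) - ∑ j ∈ Finset.range k, X ^ (e j i) * s j)) →
      (∃ j < k + r, s j ≠ 0) →
      d * (r + 1) ≤ ∑ j ∈ Finset.range (k + r), (s j).support.card) ∧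
    (∃ s : ℕ → F[X],
      (∀ j < k + r, (s j).degree < (p * τ : ℕ) ∧ (1 + X ^ τ) * g ∣ s j) ∧
      (∀ i < r, (1 + X ^ (p * τ) : F[X]) ∣
          (s (k + i) - ∑ j ∈ Finset.range k, X ^ (e j i) * s j)) ∧
      (∃ j < k + r, s j ≠ 0) ∧
      ∑ j ∈ Finset.range (k + r), (s j).support.card = d * (r + 1)) := by
  have hlower : ∀ s : ℕ → F[X],
      (∀ j < k + r, (s j).degree < (p * τ : ℕ) ∧ (1 + X ^ τ) * g ∣ s j) →
      (∀ i < r, (1 + X ^ (p * τ) : F[X]) ∣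
          (s (k + i) - ∑ j ∈ Finset.range k, X ^ (e j i) * s j)) →
      (∃ j < k + r, s j ≠ 0) →
      d * (r + 1) ≤ ∑ j ∈ Finset.range (k + r), (s j).support.card := by
    classical
    rintro s hs hpar ⟨j, hj, hsj⟩
    have hzero : ((Finset.range (k + r)).filter fun j => s j = 0).card < k := by
      by_contra! h
      obtain ⟨T, hT, hTk⟩ := Finset.exists_subset_card_eq h
      exact hsj (hmds T (hT.trans (Finset.filter_subset _ _)) hTk s hs hpar
        (fun i hi => (Finset.mem_filter.1 (hT hi)).2) j hj)
    have hcard := Finset.card_filter_add_card_filter_not (s := Finset.range (k + r))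
      (fun j => s j = 0)
    rw [Finset.card_range] at hcard
    calc d * (r + 1) ≤ d * ((Finset.range (k + r)).filter fun j => ¬ s j = 0).card :=
          Nat.mul_le_mul_left _ (by omega)
      _ = ∑ j ∈ (Finset.range (k + r)).filter (fun j => ¬ s j = 0), d := by
          rw [Finset.sum_const, smul_eq_mul, mul_comm]
      _ ≤ ∑ j ∈ (Finset.range (k + r)).filter (fun j => ¬ s j = 0), (s j).support.card := by
          refine Finset.sum_le_sum fun i hi => ?_
          obtain ⟨hi, hi0⟩ := Finset.mem_filter.1 hi
          obtain ⟨hdeg, hdvd⟩ := hs i (Finset.mem_range.1 hi)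
          exact hdmin _ hdeg hdvd hi0
      _ ≤ ∑ j ∈ Finset.range (k + r), (s j).support.card :=
          Finset.sum_le_sum_of_subset (Finset.filter_subset _ _)
  refine ⟨hlower, ?_⟩
  obtain ⟨c, hcdeg, hcdvd, hc0, hcd⟩ := hdex
  choose t htdeg htdvd htcard using fun i : ℕ =>
    exists_cyclic_shift (Nat.mul_pos hp.pos hτ) (e 0 i) c
  have hgen : (1 + X ^ τ) * g ∣ (1 + X ^ (p * τ) : F[X]) := by
    have h : (1 + X ^ (p * τ) : F[X]) =
        (1 + X ^ τ) * ∑ n ∈ Finset.range p, (X : F[X]) ^ (n * τ) := by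
      have h := mul_geom_sum ((X : F[X]) ^ τ) p
      simp only [← pow_mul, CharTwo.sub_eq_add] at h
      simp only [mul_comm _ τ]
      rw [add_comm, ← h, add_comm 1]
    rw [h]
    exact mul_dvd_mul_left _ hg
  have htmem : ∀ i, (1 + X ^ τ) * g ∣ t i := fun i =>
    (dvd_sub_left (hcdvd.mul_left (X ^ e 0 i))).1 (hgen.trans (htdvd i))
  let s : ℕ → F[X] := fun j => if j < k then (if j = 0 then c else 0) else t (j - k)
  have hs0 : s 0 = c := by simp [s, show 0 < k by omega]
  have hsmid : ∀ j < k, j ≠ 0 → s j = 0 := fun j hj hj0 => by simp [s, hj, hj0]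
  have hspar : ∀ i, s (k + i) = t i := fun i => by simp [s]
  have hmem : ∀ j < k + r, (s j).degree < (p * τ : ℕ) ∧ (1 + X ^ τ) * g ∣ s j := by
    intro j _
    simp only [s]
    split_ifs
    · exact ⟨hcdeg, hcdvd⟩
    · exact ⟨degree_zero.trans_lt (WithBot.bot_lt_coe _), dvd_zero _⟩
    · exact ⟨htdeg _, htmem _⟩
  have hpar : ∀ i < r, (1 + X ^ (p * τ) : F[X]) ∣
      (s (k + i) - ∑ j ∈ Finset.range k, X ^ (e j i) * s j) := by
    intro i _
    rw [Finset.sum_eq_single_of_mem 0 (Finset.mem_range.2 hk)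
      (fun j hj hj0 => by rw [hsmid j (Finset.mem_range.1 hj) hj0, mul_zero]), hs0, hspar]
    exact htdvd i
  have hne : ∃ j < k + r, s j ≠ 0 := ⟨0, by omega, by rwa [hs0]⟩
  refine ⟨s, hmem, hpar, hne, le_antisymm ?_ (hlower s hmem hpar hne)⟩
  rw [Finset.sum_range_add, Finset.sum_eq_single_of_mem 0 (Finset.mem_range.2 hk)
    (fun j hj hj0 => by rw [hsmid j (Finset.mem_range.1 hj) hj0]; simp), hs0, hcd]
  have hsum : ∑ i ∈ Finset.range r, (s (k + i)).support.card ≤ r * d := by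
    simpa using Finset.sum_le_card_nsmul (Finset.range r) (fun i => (s (k + i)).support.card) d
      (fun i _ => by rw [hspar, ← hcd]; exact htcard i)
  linarith
end

section
/- Let F be a field of characteristic 2, p an odd prime, τ ≥ 1, k ≥ 1, and r ∈ {2, 3} with k + r ≤ pτ. Assume the code GEBR(p, τ, k, r, 1) is MDS (for every subset T of {0, …, k+r−1} with |T| = k, the only codeword vanishing on all columns in T is zero), and let D denote its minimum symbol distance, i.e., the minimum symbol weight of a nonzero codeword. Then: (a) if r = 2 and 2τ ≤ k + 1, then D = 6; (b) if r = 2 and τ > k + 1, then D = 8; (c) if r = 3 and 3τ ≤ k + 2, then D = 8. -/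
open Polynomial

/-- The GEBR(p, τ, k, r, 1) code: every column polynomial has degree < pτ and is
divisible by 1 + x^τ, and all the parity-check equations of slopes 0,…,r−1 hold. -/
def gebrCode (F : Type*) [Field F] (p τ k r : ℕ) (s : ℕ → F[X]) : Prop :=
  (∀ j < k + r, (s j).degree < (p * τ : ℕ) ∧ (1 + X ^ τ : F[X]) ∣ s j) ∧
  (∀ ℓ < r, (1 + X ^ (p * τ) : F[X]) ∣
    ∑ j ∈ Finset.range (k + r), X ^ (ℓ * j) * s j)

/-- The set of symbol weights of nonzero codewords of GEBR(p, τ, k, r, 1). -/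
def symbolWeights (F : Type*) [Field F] (p τ k r : ℕ) : Set ℕ :=
  {w | ∃ s : ℕ → F[X], gebrCode F p τ k r s ∧ (∃ j < k + r, s j ≠ 0) ∧
    w = ∑ j ∈ Finset.range (k + r), (s j).support.card}

/-- The part of `f` supported on the exponents congruent to `c` modulo `τ`. -/
noncomputable def Polynomial.residuePart {F : Type*} [Field F] (τ : ℕ) (c : ZMod τ) (f : F[X]) :
    F[X] :=
  ∑ i ∈ f.support with ((i : ℕ) : ZMod τ) = c, monomial i (f.coeff i)

section ResiduePart

variable {F : Type*} [Field F] {τ : ℕ}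

theorem coeff_residuePart (c : ZMod τ) (f : F[X]) (n : ℕ) :
    (residuePart τ c f).coeff n = if (n : ZMod τ) = c then f.coeff n else 0 := by
  simp only [residuePart, finsetSum_coeff, coeff_monomial, Finset.sum_ite_eq', Finset.mem_filter,
    mem_support_iff]
  by_cases h : f.coeff n = 0 <;> simp [h]

theorem residuePart_one_add_X_pow_mul (c : ZMod τ) (m : ℕ) (g : F[X]) :
    residuePart τ c ((1 + X ^ (m * τ)) * g) = (1 + X ^ (m * τ)) * residuePart τ c g := by
  ext n
  simp only [coeff_residuePart, add_mul, one_mul, coeff_add, coeff_X_pow_mul']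
  by_cases h : m * τ ≤ n
  · have : ((n - m * τ : ℕ) : ZMod τ) = n := by simp [Nat.cast_sub h]
    simp only [h, this, if_true]
    split_ifs <;> simp
  · simp [h]

theorem one_add_X_pow_dvd_residuePart (c : ZMod τ) (m : ℕ) {f : F[X]}
    (h : (1 + X ^ (m * τ) : F[X]) ∣ f) : (1 + X ^ (m * τ) : F[X]) ∣ residuePart τ c f := by
  obtain ⟨g, rfl⟩ := h
  exact ⟨_, residuePart_one_add_X_pow_mul c m g⟩

theorem residuePart_sum {ι : Type*} (c : ZMod τ) (I : Finset ι) (f : ι → F[X]) :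
    residuePart τ c (∑ i ∈ I, f i) = ∑ i ∈ I, residuePart τ c (f i) := by
  ext n
  simp only [coeff_residuePart, finsetSum_coeff]
  split_ifs <;> simp

theorem residuePart_X_pow_mul_of_forall_mem {f : F[X]} {e : ZMod τ}
    (h : ∀ n ∈ f.support, (n : ZMod τ) = e) (m : ℕ) (c : ZMod τ) :
    residuePart τ c (X ^ m * f) = if e + m = c then X ^ m * f else 0 := by
  ext n
  rw [coeff_residuePart, apply_ite (fun q : F[X] => q.coeff n), coeff_zero, coeff_X_pow_mul']
  by_cases hmn : m ≤ n
  · by_cases h0 : f.coeff (n - m) = 0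
    · simp [h0]
    · have := h _ (mem_support_iff.2 h0)
      rw [Nat.cast_sub hmn] at this
      rw [← this, sub_add_cancel]
  · simp [hmn]

theorem exists_ne_mem_support_of_one_add_X_pow_dvd [CharP F 2] {f : F[X]}
    (h : (1 + X ^ τ : F[X]) ∣ f) {n : ℕ} (hn : n ∈ f.support) :
    ∃ m ∈ f.support, m ≠ n ∧ (m : ZMod τ) = n := by
  by_contra! hcon
  have hdvd := one_add_X_pow_dvd_residuePart (n : ZMod τ) 1 (by simpa using h)
  have hpart : residuePart τ (n : ZMod τ) f = monomial n (f.coeff n) := by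
    ext m
    rw [coeff_residuePart, coeff_monomial]
    by_cases hmn : m = n
    · simp [hmn]
    · by_cases hm : m ∈ f.support
      · simp [hcon m hm hmn, Ne.symm hmn]
      · simp [notMem_support_iff.1 hm, Ne.symm hmn]
  have heval := eval_dvd (x := 1) hdvd
  rw [hpart] at heval
  simp [CharTwo.add_self_eq_zero] at heval
  exact mem_support_iff.1 hn heval

theorem two_le_card_support_of_one_add_X_pow_dvd [CharP F 2] {f : F[X]}
    (h : (1 + X ^ τ : F[X]) ∣ f) (hf : f ≠ 0) : 2 ≤ f.support.card := by
  obtain ⟨n, hn⟩ := support_nonempty.2 hf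
  obtain ⟨m, hm, hmn, -⟩ := exists_ne_mem_support_of_one_add_X_pow_dvd h hn
  exact Finset.one_lt_card.2 ⟨m, hm, n, hn, hmn⟩

theorem exists_residue_of_card_support_le_three [CharP F 2] {f : F[X]}
    (h : (1 + X ^ τ : F[X]) ∣ f) (hcard : f.support.card ≤ 3) :
    ∃ e : ZMod τ, ∀ n ∈ f.support, (n : ZMod τ) = e := by
  by_cases hf : f = 0
  · exact ⟨0, by simp [hf]⟩
  obtain ⟨n, hn⟩ := support_nonempty.2 hf
  refine ⟨n, fun m hm => ?_⟩
  by_contra hne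
  obtain ⟨n', hn', hnn, hn'e⟩ := exists_ne_mem_support_of_one_add_X_pow_dvd h hn
  obtain ⟨m', hm', hmm, hm'e⟩ := exists_ne_mem_support_of_one_add_X_pow_dvd h hm
  have hsub : ({n, n', m, m'} : Finset ℕ) ⊆ f.support := by
    simp [Finset.insert_subset_iff, hn, hn', hm, hm']
  have hle := Finset.card_le_card hsub
  have hc : ({n, n', m, m'} : Finset ℕ).card = 4 := by
    rw [Finset.card_insert_of_notMem, Finset.card_insert_of_notMem,
      Finset.card_insert_of_notMem, Finset.card_singleton]
    all_goals
      simp only [Finset.mem_insert, Finset.mem_singleton]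
      grind
  omega

end ResiduePart

theorem one_add_X_pow_ne_zero {F : Type*} [Field F] {n : ℕ} (hn : 0 < n) :
    (1 + X ^ n : F[X]) ≠ 0 := fun h => by
  simpa [h] using degree_one_add_X_pow (F := F) hn

theorem isCoprime_one_add_X_pow_X_pow {F : Type*} [Field F] {n : ℕ} (hn : 0 < n) (m : ℕ) :
    IsCoprime (1 + X ^ n : F[X]) (X ^ m) := by
  obtain ⟨n, rfl⟩ := Nat.exists_eq_add_of_lt hn
  exact IsCoprime.pow_right ⟨1, -X ^ n, by ring⟩

section Code

variable {F : Type*} [Field F] {p τ k r : ℕ} {s : ℕ → F[X]}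

open scoped Classical in
theorem gebrCode.card_nonzero_columns
    (hmds : ∀ T : Finset ℕ, T ⊆ Finset.range (k + r) → T.card = k →
      ∀ s : ℕ → F[X], gebrCode F p τ k r s → (∀ j ∈ T, s j = 0) →
        ∀ j < k + r, s j = 0)
    (hs : gebrCode F p τ k r s) (hne : ∃ j < k + r, s j ≠ 0) :
    r + 1 ≤ {j ∈ Finset.range (k + r) | s j ≠ 0}.card := by
  by_contra! hlt
  have hadd := Finset.card_filter_add_card_filter_not (s := Finset.range (k + r))
    (fun j => s j ≠ 0)
  rw [Finset.card_range] at hadd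
  obtain ⟨T, hT, hTk⟩ := Finset.exists_subset_card_eq
    (s := {j ∈ Finset.range (k + r) | ¬ s j ≠ 0}) (n := k) (by omega)
  obtain ⟨j, hj, hj0⟩ := hne
  refine hj0 (hmds T (hT.trans (Finset.filter_subset _ _)) hTk s hs (fun i hi => ?_) j hj)
  exact not_not.1 (Finset.mem_filter.1 (hT hi)).2

open scoped Classical in
theorem sum_card_support_eq_sum_filter (N : ℕ) (s : ℕ → F[X]) :
    ∑ j ∈ Finset.range N, (s j).support.card =
      ∑ j ∈ Finset.range N with s j ≠ 0, (s j).support.card := by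
  refine (Finset.sum_filter_of_ne (p := fun j => s j ≠ 0) fun j _ hj h0 => hj ?_).symm
  simp [h0]

open scoped Classical in
theorem gebrCode.two_mul_card_le [CharP F 2] (hs : gebrCode F p τ k r s) :
    2 * {j ∈ Finset.range (k + r) | s j ≠ 0}.card ≤
      ∑ j ∈ Finset.range (k + r), (s j).support.card := by
  rw [sum_card_support_eq_sum_filter, mul_comm, ← smul_eq_mul]
  refine Finset.card_nsmul_le_sum _ _ _ fun j hj => ?_
  rw [Finset.mem_filter, Finset.mem_range] at hj
  exact two_le_card_support_of_one_add_X_pow_dvd (hs.1 j hj.1).2 hj.2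

theorem gebrCode.exists_residue_eq (hs : gebrCode F p τ k r s) (hpτ : 0 < p * τ)
    {e : ℕ → ZMod τ} (he : ∀ j < k + r, ∀ n ∈ (s j).support, (n : ZMod τ) = e j)
    {ℓ : ℕ} (hℓ : ℓ < r) {a : ℕ} (ha : a < k + r) (ha0 : s a ≠ 0) :
    ∃ b < k + r, s b ≠ 0 ∧ b ≠ a ∧
      e b + ((ℓ * b : ℕ) : ZMod τ) = e a + ((ℓ * a : ℕ) : ZMod τ) := by
  by_contra! hcon
  have hdvd := one_add_X_pow_dvd_residuePart (e a + ((ℓ * a : ℕ) : ZMod τ)) p (hs.2 ℓ hℓ)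
  rw [residuePart_sum, Finset.sum_eq_single_of_mem a (Finset.mem_range.2 ha) ?_,
    residuePart_X_pow_mul_of_forall_mem (he a ha), if_pos rfl] at hdvd
  · refine ha0 (eq_zero_of_dvd_of_degree_lt
      ((isCoprime_one_add_X_pow_X_pow hpτ _).dvd_of_dvd_mul_left hdvd) ?_)
    rw [degree_one_add_X_pow hpτ]
    exact (hs.1 a ha).1
  · intro b hb hba
    rw [Finset.mem_range] at hb
    rw [residuePart_X_pow_mul_of_forall_mem (he b hb)]
    by_cases hb0 : s b = 0
    · simp [hb0]
    · exact if_neg (hcon b hb hb0 hba)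

open scoped Classical in
theorem gebrCode.eight_le_sum_card_support [CharP F 2] (hs : gebrCode F p τ k 2 s)
    (hp : 0 < p) (hτk : k + 1 < τ)
    (hcard : 3 ≤ {j ∈ Finset.range (k + 2) | s j ≠ 0}.card) :
    8 ≤ ∑ j ∈ Finset.range (k + 2), (s j).support.card := by
  by_contra! hlt
  have hpτ : 0 < p * τ := Nat.mul_pos hp (by omega)
  have htwo := hs.two_mul_card_le
  obtain ⟨a, b, c, hab, hac, hbc, hZ⟩ := Finset.card_eq_three.1
    (show {j ∈ Finset.range (k + 2) | s j ≠ 0}.card = 3 by omega)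
  have hmem : ∀ j, (j < k + 2 ∧ s j ≠ 0) ↔ j = a ∨ j = b ∨ j = c := fun j => by
    simpa using Finset.ext_iff.1 hZ j
  obtain ⟨ha, ha0⟩ := (hmem a).2 (by simp)
  obtain ⟨hb, hb0⟩ := (hmem b).2 (by simp)
  obtain ⟨hc, hc0⟩ := (hmem c).2 (by simp)
  have hsum := sum_card_support_eq_sum_filter (k + 2) s
  rw [hZ, Finset.sum_insert (by simp [hab, hac]), Finset.sum_insert (by simp [hbc]),
    Finset.sum_singleton] at hsum
  have ha2 := two_le_card_support_of_one_add_X_pow_dvd (hs.1 a ha).2 ha0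
  have hb2 := two_le_card_support_of_one_add_X_pow_dvd (hs.1 b hb).2 hb0
  have hc2 := two_le_card_support_of_one_add_X_pow_dvd (hs.1 c hc).2 hc0
  have hres : ∀ j, ∃ e : ZMod τ, j < k + 2 → ∀ n ∈ (s j).support, (n : ZMod τ) = e := by
    intro j
    by_cases hj : j < k + 2
    · have hj3 : (s j).support.card ≤ 3 := by
        by_cases hj0 : s j = 0
        · simp [hj0]
        · rcases (hmem j).1 ⟨hj, hj0⟩ with rfl | rfl | rfl <;> omega
      obtain ⟨e, he⟩ := exists_residue_of_card_support_le_three (hs.1 j hj).2 hj3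
      exact ⟨e, fun _ => he⟩
    · exact ⟨0, fun h => absurd h hj⟩
  choose e he using hres
  have hpair : ∀ ℓ < 2, e a + ((ℓ * a : ℕ) : ZMod τ) = e b + ((ℓ * b : ℕ) : ZMod τ) := by
    intro ℓ hℓ
    obtain ⟨x, hx, hx0, hxa, hxe⟩ := hs.exists_residue_eq hpτ he hℓ ha ha0
    obtain ⟨y, hy, hy0, hyb, hye⟩ := hs.exists_residue_eq hpτ he hℓ hb hb0
    have hx' := (hmem x).1 ⟨hx, hx0⟩
    have hy' := (hmem y).1 ⟨hy, hy0⟩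
    grind
  have h0 := hpair 0 (by norm_num)
  have h1 := hpair 1 (by norm_num)
  simp only [zero_mul, Nat.cast_zero, add_zero, one_mul] at h0 h1
  rw [h0, add_right_inj, ZMod.natCast_eq_natCast_iff] at h1
  exact hab (h1.eq_of_lt_of_lt (by omega) (by omega))

theorem exists_symbolWeights_le {m : ℕ} (c : Fin m → ℕ) (A : Fin m → F[X])
    (hc : Function.Injective c) (hck : ∀ i, c i < k + r)
    (hA : ∀ i, (A i).degree < (p * τ : ℕ) ∧ (1 + X ^ τ : F[X]) ∣ A i)
    (hsum : ∀ ℓ < r, (1 + X ^ (p * τ) : F[X]) ∣ ∑ i, X ^ (ℓ * c i) * A i)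
    (hne : ∃ i, A i ≠ 0) :
    ∃ w ∈ symbolWeights F p τ k r, w ≤ ∑ i, (A i).support.card := by
  classical
  let s : ℕ → F[X] := Function.extend c A 0
  have hsc : ∀ i, s (c i) = A i := fun i => hc.extend_apply A 0 i
  have hs0 : ∀ j, (¬ ∃ i, c i = j) → s j = 0 := fun j hj => Function.extend_apply' _ _ _ hj
  have hsub : Finset.univ.map ⟨c, hc⟩ ⊆ Finset.range (k + r) := fun j hj => by
    obtain ⟨i, -, rfl⟩ := Finset.mem_map.1 hj
    exact Finset.mem_range.2 (hck i)
  have hout : ∀ j ∉ Finset.univ.map ⟨c, hc⟩, s j = 0 := fun j hj => hs0 j (by simpa using hj)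
  refine ⟨_, ⟨s, ⟨fun j _ => ?_, fun ℓ hℓ => ?_⟩, ?_, rfl⟩, ?_⟩
  · by_cases hj : ∃ i, c i = j
    · obtain ⟨i, rfl⟩ := hj
      rw [hsc]
      exact hA i
    · rw [hs0 j hj]
      exact ⟨degree_zero.trans_lt (WithBot.bot_lt_coe _), dvd_zero _⟩
  · rw [← Finset.sum_subset hsub fun j _ hj => by rw [hout j hj, mul_zero], Finset.sum_map]
    simpa [hsc] using hsum ℓ hℓ
  · obtain ⟨i, hi⟩ := hne
    exact ⟨c i, hck i, by rwa [hsc]⟩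
  · rw [← Finset.sum_subset hsub fun j _ hj => by rw [hout j hj]; simp, Finset.sum_map]
    simp [hsc]

theorem isLeast_symbolWeights {w : ℕ} (hlow : ∀ v ∈ symbolWeights F p τ k r, w ≤ v)
    (hex : ∃ v ∈ symbolWeights F p τ k r, v ≤ w) : IsLeast (symbolWeights F p τ k r) w := by
  obtain ⟨v, hv, hvw⟩ := hex
  exact ⟨hvw.antisymm (hlow v hv) ▸ hv, hlow⟩

theorem card_support_X_pow_add_X_pow_le (a b : ℕ) :
    (X ^ a + X ^ b : F[X]).support.card ≤ 2 := by
  refine (Finset.card_le_card support_add).trans ((Finset.card_union_le _ _).trans ?_)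
  have hX : ∀ n : ℕ, (X ^ n : F[X]).support.card ≤ 1 := fun n => by
    rw [← monomial_one_right_eq_X_pow]
    exact Finset.card_le_card (support_monomial_subset n 1)
  exact Nat.add_le_add (hX a) (hX b)

theorem degree_X_pow_add_X_pow_lt {a b n : ℕ} (ha : a < n) (hb : b < n) :
    (X ^ a + X ^ b : F[X]).degree < n := by
  refine (degree_add_le _ _).trans_lt (max_lt ?_ ?_) <;> rw [degree_X_pow] <;> exact_mod_cast ‹_›

end Code

theorem stmt_13 (F : Type*) [Field F] [CharP F 2]
    (p τ k r : ℕ) (hp : p.Prime) (hodd : p ≠ 2) (hτ : 1 ≤ τ) (hk : 1 ≤ k)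
    (hrval : r = 2 ∨ r = 3) (hkr : k + r ≤ p * τ)
    (hmds : ∀ T : Finset ℕ, T ⊆ Finset.range (k + r) → T.card = k →
      ∀ s : ℕ → F[X], gebrCode F p τ k r s → (∀ j ∈ T, s j = 0) →
        ∀ j < k + r, s j = 0) :
    (r = 2 → 2 * τ ≤ k + 1 → IsLeast (symbolWeights F p τ k r) 6) ∧
    (r = 2 → k + 1 < τ → IsLeast (symbolWeights F p τ k r) 8) ∧
    (r = 3 → 3 * τ ≤ k + 2 → IsLeast (symbolWeights F p τ k r) 8) := by
  have h2 : (2 : F[X]) = 0 := CharTwo.two_eq_zero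
  have hp3 : 3 ≤ p := lt_of_le_of_ne hp.two_le (Ne.symm hodd)
  have hpτ : 3 * τ ≤ p * τ := Nat.mul_le_mul_right τ hp3
  have hlow : ∀ v ∈ symbolWeights F p τ k r, 2 * (r + 1) ≤ v := by
    rintro _ ⟨s, hs, hne, rfl⟩
    exact (Nat.mul_le_mul_left 2 (hs.card_nonzero_columns hmds hne)).trans hs.two_mul_card_le
  refine ⟨?_, ?_, ?_⟩
  · rintro rfl h
    refine isLeast_symbolWeights hlow ?_
    obtain ⟨w, hw, hle⟩ := exists_symbolWeights_le (F := F) (p := p) (τ := τ) (k := k) (r := 2)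
      ![0, τ, 2 * τ] ![X ^ τ + X ^ (2 * τ), X ^ 0 + X ^ (2 * τ), X ^ 0 + X ^ τ]
      (by intro i j; fin_cases i <;> fin_cases j <;> simp <;> omega)
      (by intro i; fin_cases i <;> simp <;> omega)
      (by
        intro i
        fin_cases i <;>
          simp only [Fin.zero_eta, Fin.mk_one, Fin.reduceFinMk, Matrix.cons_val]
        · exact ⟨degree_X_pow_add_X_pow_lt (by omega) (by omega), X ^ τ, by ring⟩
        · exact ⟨degree_X_pow_add_X_pow_lt (by omega) (by omega), 1 + X ^ τ, by
            linear_combination (-X ^ τ) * h2⟩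
        · exact ⟨degree_X_pow_add_X_pow_lt (by omega) (by omega), 1, by ring⟩)
      (by
        intro ℓ hℓ
        convert dvd_zero _
        simp only [Fin.sum_univ_three, Matrix.cons_val]
        interval_cases ℓ
        · linear_combination (1 + X ^ τ + X ^ (2 * τ)) * h2
        · linear_combination (X ^ τ + X ^ (2 * τ) + X ^ (3 * τ)) * h2)
      ⟨2, by simpa using one_add_X_pow_ne_zero (F := F) hτ⟩
    refine ⟨w, hw, hle.trans ?_⟩
    simp only [Fin.sum_univ_three, Matrix.cons_val]
    have := card_support_X_pow_add_X_pow_le (F := F) τ (2 * τ)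
    have := card_support_X_pow_add_X_pow_le (F := F) 0 (2 * τ)
    have := card_support_X_pow_add_X_pow_le (F := F) 0 τ
    omega
  · rintro rfl h
    refine isLeast_symbolWeights ?_ ?_
    · rintro _ ⟨s, hs, hne, rfl⟩
      exact hs.eight_le_sum_card_support hp.pos h (hs.card_nonzero_columns hmds hne)
    obtain ⟨w, hw, hle⟩ := exists_symbolWeights_le (F := F) (p := p) (τ := τ) (k := k) (r := 2)
      ![0, 1, 2] ![X ^ 1 + X ^ (τ + 1), (X ^ 0 + X ^ 1) + (X ^ τ + X ^ (τ + 1)), X ^ 0 + X ^ τ]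
      (by intro i j; fin_cases i <;> fin_cases j <;> simp)
      (by intro i; fin_cases i <;> simp; omega)
      (by
        intro i
        fin_cases i <;>
          simp only [Fin.zero_eta, Fin.mk_one, Fin.reduceFinMk, Matrix.cons_val]
        · exact ⟨degree_X_pow_add_X_pow_lt (by omega) (by omega), X, by ring⟩
        · exact ⟨(degree_add_le _ _).trans_lt (max_lt
            (degree_X_pow_add_X_pow_lt (by omega) (by omega))
            (degree_X_pow_add_X_pow_lt (by omega) (by omega))), 1 + X, by ring⟩
        · exact ⟨degree_X_pow_add_X_pow_lt (by omega) (by omega), 1, by ring⟩)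
      (by
        intro ℓ hℓ
        convert dvd_zero _
        simp only [Fin.sum_univ_three, Matrix.cons_val]
        interval_cases ℓ
        · linear_combination (1 + X + X ^ τ + X ^ (τ + 1)) * h2
        · linear_combination (X + X ^ 2 + X ^ (τ + 1) + X ^ (τ + 2)) * h2)
      ⟨2, by simpa using one_add_X_pow_ne_zero (F := F) hτ⟩
    refine ⟨w, hw, hle.trans ?_⟩
    simp only [Fin.sum_univ_three, Matrix.cons_val]
    have := card_support_X_pow_add_X_pow_le (F := F) 1 (τ + 1)
    have := card_support_X_pow_add_X_pow_le (F := F) 0 1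
    have := card_support_X_pow_add_X_pow_le (F := F) τ (τ + 1)
    have := card_support_X_pow_add_X_pow_le (F := F) 0 τ
    have := (Finset.card_le_card (support_add (p := (X ^ 0 + X ^ 1 : F[X]))
      (q := X ^ τ + X ^ (τ + 1)))).trans (Finset.card_union_le _ _)
    omega
  · rintro rfl h
    have hp5 : 5 ≤ p := by
      have hp3' : p ≠ 3 := by
        rintro rfl
        omega
      have hp4 : p ≠ 4 := by
        rintro rfl
        exact absurd hp (by norm_num)
      omega
    have hpτ5 : 5 * τ ≤ p * τ := Nat.mul_le_mul_right τ hp5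
    refine isLeast_symbolWeights hlow ?_
    obtain ⟨w, hw, hle⟩ := exists_symbolWeights_le (F := F) (p := p) (τ := τ) (k := k) (r := 3)
      ![0, τ, 2 * τ, 3 * τ]
      ![X ^ (3 * τ) + X ^ (4 * τ), X ^ τ + X ^ (4 * τ), X ^ 0 + X ^ (3 * τ), X ^ 0 + X ^ τ]
      (by intro i j; fin_cases i <;> fin_cases j <;> simp <;> omega)
      (by intro i; fin_cases i <;> simp <;> omega)
      (by
        intro i
        fin_cases i <;>
          simp only [Fin.zero_eta, Fin.mk_one, Fin.reduceFinMk, Matrix.cons_val]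
        · exact ⟨degree_X_pow_add_X_pow_lt (by omega) (by omega), X ^ (3 * τ), by ring⟩
        · exact ⟨degree_X_pow_add_X_pow_lt (by omega) (by omega),
            X ^ τ * (1 + X ^ τ + X ^ (2 * τ)), by
              linear_combination (-X ^ (2 * τ) - X ^ (3 * τ)) * h2⟩
        · exact ⟨degree_X_pow_add_X_pow_lt (by omega) (by omega),
            1 + X ^ τ + X ^ (2 * τ), by
              linear_combination (-X ^ τ - X ^ (2 * τ)) * h2⟩
        · exact ⟨degree_X_pow_add_X_pow_lt (by omega) (by omega), 1, by ring⟩)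
      (by
        intro ℓ hℓ
        convert dvd_zero _
        simp only [Fin.sum_univ_four, Matrix.cons_val]
        interval_cases ℓ
        · linear_combination (1 + X ^ τ + X ^ (3 * τ) + X ^ (4 * τ)) * h2
        · linear_combination (X ^ (2 * τ) + X ^ (3 * τ) + X ^ (4 * τ) + X ^ (5 * τ)) * h2
        · linear_combination (X ^ (3 * τ) + X ^ (4 * τ) + X ^ (6 * τ) + X ^ (7 * τ)) * h2)
      ⟨3, by simpa using one_add_X_pow_ne_zero (F := F) hτ⟩
    refine ⟨w, hw, hle.trans ?_⟩
    simp only [Fin.sum_univ_four, Matrix.cons_val]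
    have := card_support_X_pow_add_X_pow_le (F := F) (3 * τ) (4 * τ)
    have := card_support_X_pow_add_X_pow_le (F := F) τ (4 * τ)
    have := card_support_X_pow_add_X_pow_le (F := F) 0 (3 * τ)
    have := card_support_X_pow_add_X_pow_le (F := F) 0 τ
    omega
end

section
/- Let F be a field of characteristic 2, p an odd prime, τ ≥ 1, k ≥ 1, r = 4, with k + 4 ≤ pτ and 4τ ≤ k + 3. Assume the code GEBR(p, τ, k, 4, 1) is MDS (for every subset T of {0, …, k+3} with |T| = k, the only codeword vanishing on all columns in T is zero). Then the minimum symbol distance of the code is at most 12; that is, there exists a nonzero codeword whose symbol weight is at most 12. -/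
open Polynomial

/-- The coefficient of `y ^ a` in `(1 + u) * ∏ ℓ < 4, (y + u ^ ℓ)` over `𝔽₂` is the sum of `u ^ e`
over the exponents `e` in this set. -/
def slopeProductExponents : ℕ → Finset ℕ
  | 0 => {6, 7}
  | 1 => {3, 7}
  | 2 => {1, 3, 4, 6}
  | 3 => {0, 4}
  | 4 => {0, 1}
  | _ => ∅

/-- The coefficient of `y ^ a` in `(1 + u) * ∏ ℓ < 4, (y + u ^ ℓ)` at `u = X ^ τ`, with exponents
of `u` reduced modulo `p`. -/
noncomputable def slopeProductColumn (F : Type*) [Field F] (p τ a : ℕ) : F[X] :=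
  ∑ e ∈ slopeProductExponents a, X ^ (e % p * τ)

/-- The word whose column `a * τ` is `slopeProductColumn F p τ a` for `a < 5`, and whose other
columns vanish. -/
noncomputable def slopeProductWord (F : Type*) [Field F] (p τ j : ℕ) : F[X] :=
  ∑ a ∈ Finset.range 5, if j = a * τ then slopeProductColumn F p τ a else 0

theorem sum_mul_pow_slopeProductExponents {R : Type*} [CommRing R] (h : (2 : R) = 0) (u : R)
    {ℓ : ℕ} (hℓ : ℓ < 4) :
    ∑ a ∈ Finset.range 5, u ^ (ℓ * a) * ∑ e ∈ slopeProductExponents a, u ^ e = 0 := by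
  interval_cases ℓ <;> simp [Finset.sum_range_succ, slopeProductExponents]
  · linear_combination (u ^ 7 + u ^ 6 + u ^ 4 + u ^ 3 + u + 1) * h
  · linear_combination (u ^ 8 + u ^ 7 + u ^ 6 + u ^ 5 + u ^ 4 + u ^ 3) * h
  · linear_combination (u ^ 10 + u ^ 9 + u ^ 8 + u ^ 7 + u ^ 6 + u ^ 5) * h
  · linear_combination (u ^ 13 + u ^ 12 + u ^ 10 + u ^ 9 + u ^ 7 + u ^ 6) * h

theorem card_slopeProductExponents_even (a : ℕ) : Even (slopeProductExponents a).card := by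
  unfold slopeProductExponents
  split <;> decide

theorem Polynomial.card_support_sum_le {R ι : Type*} [Semiring R] (s : Finset ι) (f : ι → R[X]) :
    (∑ i ∈ s, f i).support.card ≤ ∑ i ∈ s, (f i).support.card :=
  Finset.le_sum_of_subadditive (fun q : R[X] => q.support.card) (by simp)
    (fun _ _ => (Finset.card_le_card support_add).trans (Finset.card_union_le _ _)) s f

section

variable {F : Type*} [Field F]

theorem degree_slopeProductColumn_lt {p τ : ℕ} (hp : 0 < p) (hτ : 0 < τ) (a : ℕ) :
    (slopeProductColumn F p τ a).degree < (p * τ : ℕ) := by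
  refine (degree_sum_le _ _).trans_lt ((Finset.sup_lt_iff (WithBot.bot_lt_coe _)).2 fun e _ => ?_)
  rw [degree_X_pow, Nat.cast_lt]
  exact Nat.mul_lt_mul_of_pos_right (Nat.mod_lt e hp) hτ

theorem card_support_slopeProductColumn_le (p τ a : ℕ) :
    (slopeProductColumn F p τ a).support.card ≤ (slopeProductExponents a).card := by
  refine (card_support_sum_le _ _).trans ?_
  rw [Finset.card_eq_sum_ones]
  exact Finset.sum_le_sum fun e _ => by simp [support_X_pow]

theorem one_add_X_pow_dvd_slopeProductColumn [CharP F 2] (p τ a : ℕ) :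
    (1 + X ^ τ : F[X]) ∣ slopeProductColumn F p τ a := by
  have h2 : (2 : F[X]) = 0 := CharTwo.two_eq_zero
  rw [← Ideal.Quotient.eq_zero_iff_dvd]
  set φ := Ideal.Quotient.mk (Ideal.span {(1 + X ^ τ : F[X])})
  have hu : φ (X ^ τ) = 1 := by
    have h : φ (1 + X ^ τ) = 0 := (Ideal.Quotient.eq_zero_iff_dvd _ _).2 dvd_rfl
    have h2' := congrArg φ h2
    simp only [map_add, map_one, map_ofNat, map_zero] at h h2'
    linear_combination h - h2'
  obtain ⟨m, hm⟩ := card_slopeProductExponents_even a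
  have h2' := congrArg φ h2
  simp only [map_ofNat, map_zero] at h2'
  simp only [slopeProductColumn, map_sum, pow_mul', map_pow φ (X ^ τ), hu, one_pow,
    Finset.sum_const, nsmul_eq_mul, mul_one, hm, Nat.cast_add]
  linear_combination (m : F[X] ⧸ Ideal.span {(1 + X ^ τ : F[X])}) * h2'

theorem one_add_X_pow_dvd_sum_slopeProductColumn [CharP F 2] (p τ : ℕ) {ℓ : ℕ} (hℓ : ℓ < 4) :
    (1 + X ^ (p * τ) : F[X]) ∣
      ∑ a ∈ Finset.range 5, X ^ (ℓ * (a * τ)) * slopeProductColumn F p τ a := by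
  have h2 : (2 : F[X]) = 0 := CharTwo.two_eq_zero
  rw [← Ideal.Quotient.eq_zero_iff_dvd]
  set φ := Ideal.Quotient.mk (Ideal.span {(1 + X ^ (p * τ) : F[X])})
  have h2' := congrArg φ h2
  simp only [map_ofNat, map_zero] at h2'
  have hX (m : ℕ) : φ (X ^ (m * τ)) = φ (X ^ τ) ^ m :=
    (congrArg φ (pow_mul' X m τ)).trans (map_pow φ _ m)
  have hu : φ (X ^ τ) ^ p = 1 := by
    have h : φ (1 + X ^ (p * τ)) = 0 := (Ideal.Quotient.eq_zero_iff_dvd _ _).2 dvd_rfl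
    rw [map_add, map_one, hX] at h
    linear_combination h - h2'
  rw [← sum_mul_pow_slopeProductExponents h2' (φ (X ^ τ)) hℓ, map_sum]
  refine Finset.sum_congr rfl fun a _ => ?_
  rw [map_mul, ← mul_assoc, hX, slopeProductColumn, map_sum]
  congr 1
  exact Finset.sum_congr rfl fun e _ => by rw [hX, ← pow_eq_pow_mod e hu]

theorem slopeProductWord_mem_gebrCode [CharP F 2] {p τ k : ℕ} (hp : 0 < p) (hτ : 0 < τ)
    (hτk : 4 * τ < k + 4) : gebrCode F p τ k 4 (slopeProductWord F p τ) := by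
  refine ⟨fun j _ => ⟨?_, Finset.dvd_sum fun a _ => ?_⟩, fun ℓ hℓ => ?_⟩
  · refine (degree_sum_le _ _).trans_lt
      ((Finset.sup_lt_iff (WithBot.bot_lt_coe _)).2 fun a _ => ?_)
    split_ifs
    · exact degree_slopeProductColumn_lt hp hτ a
    · exact degree_zero.trans_lt (WithBot.bot_lt_coe _)
  · split_ifs
    · exact one_add_X_pow_dvd_slopeProductColumn p τ a
    · exact dvd_zero _
  · convert one_add_X_pow_dvd_sum_slopeProductColumn (F := F) p τ hℓ using 1
    simp only [slopeProductWord, Finset.mul_sum, mul_ite, mul_zero]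
    rw [Finset.sum_comm]
    refine Finset.sum_congr rfl fun a ha => ?_
    have : a * τ ≤ 4 * τ := Nat.mul_le_mul_right τ (by have := Finset.mem_range.1 ha; omega)
    rw [Finset.sum_ite_eq', if_pos (Finset.mem_range.2 (by omega))]

theorem slopeProductWord_four_mul_ne_zero {p τ : ℕ} (hp : 1 < p) (hτ : 0 < τ) :
    slopeProductWord F p τ (4 * τ) ≠ 0 := by
  have h : slopeProductWord F p τ (4 * τ) = 1 + X ^ τ := by
    simp [slopeProductWord, hτ.ne', slopeProductColumn,
      slopeProductExponents, Nat.mod_eq_of_lt hp]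
  intro h0
  have := congrArg (fun q : F[X] => q.coeff 0) (h.symm.trans h0)
  simp [coeff_X_pow, hτ.ne] at this

theorem sum_card_support_slopeProductWord_le (p τ n : ℕ) :
    ∑ j ∈ Finset.range n, (slopeProductWord F p τ j).support.card ≤ 12 := by
  calc
    _ ≤ ∑ j ∈ Finset.range n, ∑ a ∈ Finset.range 5,
        if j = a * τ then (slopeProductExponents a).card else 0 := by
      refine Finset.sum_le_sum fun j _ => ?_
      refine (card_support_sum_le _ _).trans (Finset.sum_le_sum fun a _ => ?_)
      split_ifs
      · exact card_support_slopeProductColumn_le p τ a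
      · simp
    _ ≤ ∑ a ∈ Finset.range 5, (slopeProductExponents a).card := by
      rw [Finset.sum_comm]
      refine Finset.sum_le_sum fun a _ => ?_
      rw [Finset.sum_ite_eq']
      split_ifs <;> simp
    _ = 12 := by decide

end

theorem stmt_14 (F : Type*) [Field F] [CharP F 2]
    (p τ k : ℕ) (hp : p.Prime) (hodd : p ≠ 2) (hτ : 1 ≤ τ) (hk : 1 ≤ k)
    (hkr : k + 4 ≤ p * τ) (hτk : 4 * τ ≤ k + 3)
    (hmds : ∀ T : Finset ℕ, T ⊆ Finset.range (k + 4) → T.card = k →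
      ∀ s : ℕ → F[X], gebrCode F p τ k 4 s → (∀ j ∈ T, s j = 0) →
        ∀ j < k + 4, s j = 0) :
    ∃ s : ℕ → F[X], gebrCode F p τ k 4 s ∧ (∃ j < k + 4, s j ≠ 0) ∧
      ∑ j ∈ Finset.range (k + 4), (s j).support.card ≤ 12 :=
  ⟨slopeProductWord F p τ, slopeProductWord_mem_gebrCode hp.pos hτ (by omega),
    ⟨4 * τ, by omega, slopeProductWord_four_mul_ne_zero hp.one_lt hτ⟩,
    sum_card_support_slopeProductWord_le p τ (k + 4)⟩
end

section
/- Let F be a field of characteristic 2, let p be an odd prime and τ ≥ 1. Let i and j be integers with 0 ≤ i < pτ and 1 ≤ j ≤ p − 1, and set s = x^i·(1 + x^{jτ}) ∈ F[x]. Let a and b be integers with 0 < a < τ, 0 < b < τ and a ≠ b. If c ∈ F[x] satisfies deg c < pτ, (1 + x^τ) divides c, and (1 + x^{pτ}) divides (1 + x^a)·c − (1 + x^b)·s, then c has more than 2 nonzero coefficients. -/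
open Polynomial

/-- The sum of the coefficients of a polynomial at exponents congruent to `r` modulo `N`, that is,
the coefficient at `r` of its class modulo `X ^ N - 1`. -/
noncomputable def coeffMod (F : Type*) [Field F] (N : ℕ) (r : ZMod N) : F[X] →ₗ[F] F :=
  Polynomial.lsum fun k => if (k : ZMod N) = r then LinearMap.id else 0

lemma coeffMod_C_mul_X_pow {F : Type*} [Field F] (N : ℕ) (r : ZMod N) (k : ℕ) (u : F) :
    coeffMod F N r (C u * X ^ k) = if (k : ZMod N) = r then u else 0 := by
  rw [C_mul_X_pow_eq_monomial, coeffMod, Polynomial.lsum_apply, Polynomial.sum_monomial_index]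
  · split_ifs <;> simp
  · simp

lemma coeffMod_X_pow {F : Type*} [Field F] (N : ℕ) (r : ZMod N) (k : ℕ) :
    coeffMod F N r (X ^ k) = if (k : ZMod N) = r then 1 else 0 := by
  simpa using coeffMod_C_mul_X_pow N r k (1 : F)

lemma coeffMod_eq_zero_of_dvd {F : Type*} [Field F] [CharP F 2] {N : ℕ} (r : ZMod N) {f : F[X]}
    (hf : (1 + X ^ N : F[X]) ∣ f) : coeffMod F N r f = 0 := by
  obtain ⟨q, rfl⟩ := hf
  induction q using Polynomial.induction_on' with
  | add q₁ q₂ h₁ h₂ => rw [mul_add, map_add, h₁, h₂, add_zero]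
  | monomial k u =>
    have h : (1 + X ^ N : F[X]) * monomial k u = C u * X ^ k + C u * X ^ (k + N) := by
      rw [← C_mul_X_pow_eq_monomial]; ring
    rw [h, map_add, coeffMod_C_mul_X_pow, coeffMod_C_mul_X_pow]
    simp only [Nat.cast_add, CharP.cast_eq_zero, add_zero]
    exact CharTwo.add_self_eq_zero _

lemma exists_binomial_of_dvd_of_card_support_le_two {F : Type*} [Field F] [CharP F 2] {τ : ℕ}
    {c : F[X]} (hc : (1 + X ^ τ : F[X]) ∣ c) (hcard : c.support.card ≤ 2) :
    ∃ (m n : ℕ) (u v : F), c = C u * X ^ m + C v * X ^ n ∧ (m : ZMod τ) = n := by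
  rcases Nat.lt_or_ge c.support.card 2 with h | h
  · obtain ⟨m, u, rfl⟩ := card_support_le_one_iff_monomial.1 (Nat.lt_succ_iff.1 h)
    exact ⟨m, m, u, 0, by simp [C_mul_X_pow_eq_monomial], rfl⟩
  · obtain ⟨m, n, -, u, v, hu, -, rfl⟩ := card_support_eq_two.1 (le_antisymm hcard h)
    refine ⟨m, n, u, v, rfl, ?_⟩
    by_contra hmn
    have := coeffMod_eq_zero_of_dvd (m : ZMod τ) hc
    rw [map_add, coeffMod_C_mul_X_pow, coeffMod_C_mul_X_pow, if_pos rfl,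
      if_neg (Ne.symm hmn), add_zero] at this
    exact hu this

/-- If the corners `i, i', i + b, i' + b` of a parallelogram lie among the corners
`m, n, m + a, n + a` of another one, where `π` identifies `m` with `n` and `i` with `i'`, then
`b` agrees with `-a` under `π` and up to an element of order two. -/
lemma two_nsmul_add_eq_zero_of_mem_parallelogram {A B : Type*} [AddCommGroup A] [AddCommGroup B]
    (π : A →+ B) {m n i i' a b : A} (hmn : π m = π n) (hii : π i = π i') (hne : i ≠ i')
    (hb : π b ≠ 0) (hab : π a ≠ π b)
    (h : ∀ x, x = i ∨ x = i' ∨ x = i + b ∨ x = i' + b →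
      x = m ∨ x = n ∨ x = m + a ∨ x = n + a) :
    π (a + b) = 0 ∧ 2 • (a + b) = 0 := by
  have key : ∀ x, π x = π i → x = i ∨ x = i' → (x = m + a ∨ x = n + a) ∧
      (x + b = m ∨ x + b = n) := by
    intro x hx hxi
    have h₁ := h x (by tauto)
    have h₂ := h (x + b) (by rcases hxi with rfl | rfl <;> simp)
    have e : ∀ y z, y = z → π y = π z := fun y z hyz => hyz ▸ rfl
    have hx₁ : x = m + a ∨ x = n + a := by
      by_contra hcon
      have hxm : π x = π m := by grind
      have : π (x + b) = π m ∨ π (x + b) = π m + π a := by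
        rcases h₂ with h₂ | h₂ | h₂ | h₂ <;> simp [h₂, hmn]
      rw [map_add, hxm] at this
      rcases this with h₃ | h₃
      · exact hb (by simpa using h₃)
      · exact hab (add_left_cancel h₃).symm
    have hxm : π x = π m + π a := by rcases hx₁ with h₃ | h₃ <;> simp [h₃, hmn]
    refine ⟨hx₁, ?_⟩
    by_contra hcon
    have : π (x + b) = π m + π a := by
      rcases h₂ with h₂ | h₂ | h₂ | h₂
      · tauto
      · tauto
      all_goals simp [h₂, hmn]
    rw [map_add, hxm] at this
    exact hb (by simpa using this)
  obtain ⟨h₁, h₂⟩ := key i rfl (Or.inl rfl)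
  obtain ⟨h₃, h₄⟩ := key i' hii.symm (Or.inr rfl)
  constructor
  · have e₁ : π i = π m + π a := by rcases h₁ with h | h <;> simp [h, hmn]
    have e₂ : π i + π b = π m := by
      rw [← map_add]; rcases h₂ with h | h <;> simp [h, hmn]
    rw [e₁, add_assoc, add_eq_left] at e₂
    rw [map_add, e₂]
  · rw [two_nsmul]
    clear h key hb hab hii hmn
    grind

theorem stmt_15 (F : Type*) [Field F] [CharP F 2]
    (p τ : ℕ) (hp : p.Prime) (hodd : p ≠ 2) (hτ : 1 ≤ τ)
    (i j : ℕ) (hi : i < p * τ) (hj1 : 1 ≤ j) (hj2 : j ≤ p - 1)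
    (a b : ℕ) (ha1 : 0 < a) (ha2 : a < τ) (hb1 : 0 < b) (hb2 : b < τ)
    (hab : a ≠ b)
    (c : F[X]) (hcdeg : c.degree < (p * τ : ℕ))
    (hcdvd : (1 + X ^ τ : F[X]) ∣ c)
    (hmod : (1 + X ^ (p * τ) : F[X]) ∣
      ((1 + X ^ a) * c - (1 + X ^ b) * (X ^ i * (1 + X ^ (j * τ))))) :
    2 < c.support.card := by
  by_contra! hcard
  obtain ⟨m, n, u, v, rfl, hmn⟩ := exists_binomial_of_dvd_of_card_support_le_two hcdvd hcard
  have hp2 := hp.two_le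
  let π : ZMod (p * τ) →+* ZMod τ := ZMod.castHom (dvd_mul_left τ p) (ZMod τ)
  have hb : (b : ZMod τ) ≠ 0 := fun h =>
    Nat.not_dvd_of_pos_of_lt hb1 hb2 ((ZMod.natCast_eq_zero_iff b τ).1 h)
  have hab' : (a : ZMod τ) ≠ b := fun h =>
    hab (Nat.ModEq.eq_of_lt_of_lt ((ZMod.natCast_eq_natCast_iff a b τ).1 h) ha2 hb2)
  have hj : ((j * τ : ℕ) : ZMod (p * τ)) ≠ 0 := fun h =>
    Nat.not_dvd_of_pos_of_lt hj1 (by omega : j < p)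
      (Nat.dvd_of_mul_dvd_mul_right hτ ((ZMod.natCast_eq_zero_iff _ _).1 h))
  have hexp : (1 + X ^ a) * (C u * X ^ m + C v * X ^ n) -
      (1 + X ^ b) * (X ^ i * (1 + X ^ (j * τ))) =
      (C u * X ^ m + C v * X ^ n + C u * X ^ (m + a) + C v * X ^ (n + a)) -
      (X ^ i + X ^ (i + j * τ) + X ^ (i + b) + X ^ (i + j * τ + b) : F[X]) := by ring
  rw [hexp] at hmod
  have hcoeff := fun r => coeffMod_eq_zero_of_dvd r hmod
  simp only [map_sub, map_add, coeffMod_C_mul_X_pow, coeffMod_X_pow] at hcoeff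
  have hπb : ∀ x y : ZMod (p * τ), π x = π y → x ≠ y + b := by
    intro x y hxy h
    rw [h, map_add, map_natCast, add_eq_left] at hxy
    exact hb hxy
  have hπi : π (i : ZMod (p * τ)) = π ((i + j * τ : ℕ) : ZMod (p * τ)) := by
    simp only [map_natCast]
    simp
  have hne : (i : ZMod (p * τ)) ≠ ((i + j * τ : ℕ) : ZMod (p * τ)) := by
    rw [Nat.cast_add]
    intro h
    exact hj (by simpa using h)
  have h₁ := hπb _ _ (rfl : π i = π i)
  have h₂ := hπb _ _ hπi
  have h₃ := hπb _ _ hπi.symm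
  have h₄ := hπb _ _ (rfl : π ((i + j * τ : ℕ) : ZMod (p * τ)) = _)
  have hmem : ∀ x : ZMod (p * τ), x = i ∨ x = (i + j * τ : ℕ) ∨ x = (i : ZMod (p * τ)) + b ∨
      x = ((i + j * τ : ℕ) : ZMod (p * τ)) + b →
      x = m ∨ x = n ∨ x = (m : ZMod (p * τ)) + a ∨ x = (n : ZMod (p * τ)) + a := by
    intro x hx
    by_contra! hcon
    obtain ⟨k₁, k₂, k₃, k₄⟩ := hcon
    have hx0 := hcoeff x
    rw [Nat.cast_add m a, Nat.cast_add n a, Nat.cast_add i b, Nat.cast_add (i + j * τ) b,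
      if_neg k₁.symm, if_neg k₂.symm, if_neg k₃.symm, if_neg k₄.symm] at hx0
    have hne' : (i : ZMod (p * τ)) + b ≠ ((i + j * τ : ℕ) : ZMod (p * τ)) + b :=
      fun h => hne (add_right_cancel h)
    rcases hx with rfl | rfl | rfl | rfl
    · simp [hne.symm, h₁.symm, h₂.symm, -Nat.cast_add] at hx0
    · simp [hne, h₃.symm, h₄.symm, -Nat.cast_add] at hx0
    · simp [h₁, h₃, hne'.symm, -Nat.cast_add] at hx0
    · simp [h₂, h₄, hne', -Nat.cast_add] at hx0
  obtain ⟨hτab, h2⟩ := two_nsmul_add_eq_zero_of_mem_parallelogram π.toAddMonoidHom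
    (by simpa using hmn) hπi hne (by simpa using hb) (by simpa using hab') hmem
  have hτab' : ((a + b : ℕ) : ZMod τ) = 0 := by simpa using hτab
  rw [ZMod.natCast_eq_zero_iff] at hτab'
  have hsum : a + b = τ := by
    obtain ⟨k, hk⟩ := hτab'
    have : k < 2 := by by_contra! h; nlinarith
    interval_cases k <;> omega
  have h2' : ((2 * (a + b) : ℕ) : ZMod (p * τ)) = 0 := by
    simpa [nsmul_eq_mul, mul_add] using h2
  rw [ZMod.natCast_eq_zero_iff, hsum] at h2'
  have := Nat.le_of_dvd two_pos (Nat.dvd_of_mul_dvd_mul_right hτ h2')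
  omega
end

section
/- Let F be a field of characteristic 2, let p be an odd prime, τ ≥ 1, and let k, r ≥ 1 with k + r ≤ pτ. Let a : Z_{pτ} × {0, …, k+r−1} → F be an array satisfying (i) Σ_{ℓ=0}^{p−1} a_{μ + ℓτ, j} = 0 for every column j and every μ ∈ Z_{pτ} (row indices modulo pτ), and (ii) Σ_{j=0}^{k+r−1} a_{t − ℓ·j, j} = 0 for every ℓ ∈ {0, …, r−1} and every t ∈ Z_{pτ}. Fix a slope i ∈ {0, …, r−1} and elements e_1, …, e_τ ∈ Z_{pτ} such that for all α ≠ β the difference e_α − e_β is not divisible by τ (this is well defined modulo pτ since τ divides pτ). If a vanishes at every position outside the union of the τ lines of slope i through e_1, …, e_τ, then a is identically zero. Hence GEBR(p, τ, k, r, q, 1) can recover any such τ erased lines of slope i. -/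
theorem stmt_17 (F : Type*) [Field F] [CharP F 2]
    (p τ k r : ℕ) (hp : p.Prime) (hodd : p ≠ 2) (hτ : 1 ≤ τ)
    (hk : 1 ≤ k) (hr : 1 ≤ r) (hkr : k + r ≤ p * τ)
    (a : ZMod (p * τ) → ℕ → F)
    (hcol : ∀ j < k + r, ∀ μ : ZMod (p * τ),
      ∑ ℓ ∈ Finset.range p, a (μ + ((ℓ * τ : ℕ) : ZMod (p * τ))) j = 0)
    (hline : ∀ ℓ < r, ∀ t : ZMod (p * τ),
      ∑ j ∈ Finset.range (k + r), a (t - ((ℓ * j : ℕ) : ZMod (p * τ))) j = 0)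
    (i : ℕ) (hi : i < r)
    (e : Fin τ → ZMod (p * τ))
    (he : ∀ α β : Fin τ, α ≠ β → ¬ (τ ∣ (e α - e β).val))
    (hvanish : ∀ t : ZMod (p * τ), ∀ j < k + r,
      (∀ u : Fin τ, t ≠ e u - ((i * j : ℕ) : ZMod (p * τ))) → a t j = 0) :
    ∀ t : ZMod (p * τ), ∀ j < k + r, a t j = 0 := by
  intro t j hj
  by_cases ht : ∀ u : Fin τ, t ≠ e u - ((i * j : ℕ) : ZMod (p * τ))
  · exact hvanish t j hj ht
  push Not at ht
  obtain ⟨u, hu⟩ := ht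
  have h := hcol j hj t
  rw [Finset.sum_eq_single_of_mem 0 (Finset.mem_range.2 hp.pos)] at h
  · simpa using h
  intro ℓ hℓ hℓ0
  refine hvanish _ j hj fun v hv => ?_
  have hlt : ℓ * τ < p * τ := Nat.mul_lt_mul_of_pos_right (Finset.mem_range.1 hℓ) hτ
  have hsub : e v - e u = ((ℓ * τ : ℕ) : ZMod (p * τ)) := by
    rw [hu] at hv
    linear_combination -hv
  have hval : (e v - e u).val = ℓ * τ := by rw [hsub, ZMod.val_natCast_of_lt hlt]
  have hvu : v = u := by
    by_contra hne
    exact he v u hne (hval ▸ Dvd.intro_left ℓ rfl)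
  rw [hvu, sub_self, ZMod.val_zero] at hval
  exact mul_ne_zero hℓ0 (by omega) hval.symm
end

section
/- Let F be a field of characteristic 2, let p be an odd prime, τ ≥ 2, k ≥ 1, r = 2, and assume pτ > 2(k+1). Let a : Z_{pτ} × {0, …, k+1} → F be an array satisfying (i) Σ_{ℓ=0}^{p−1} a_{μ + ℓτ, j} = 0 for every column j and every μ ∈ Z_{pτ}, and (ii) Σ_{j=0}^{k+1} a_{t − ℓ·j, j} = 0 for ℓ ∈ {0, 1} and every t ∈ Z_{pτ}. Fix a slope i ∈ {0, 1} and two distinct elements e_1, e_2 ∈ Z_{pτ}. If a vanishes at every position outside the union of the two lines of slope i through e_1 and e_2, then a is identically zero. Hence GEBR(p, τ, k, 2, q, 1) can recover any two erased lines of slope 0 or of slope 1. -/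
/-- Multiples `ℓ * τ` with `ℓ < p` are pairwise distinct in `ZMod (p * τ)`. -/
theorem natCast_mul_injOn_lt {p τ : ℕ} (hτ : 0 < τ) {l m : ℕ} (hl : l < p) (hm : m < p)
    (h : ((l * τ : ℕ) : ZMod (p * τ)) = ((m * τ : ℕ) : ZMod (p * τ))) : l = m := by
  rw [ZMod.natCast_eq_natCast_iff', Nat.mod_eq_of_lt (by gcongr), Nat.mod_eq_of_lt (by gcongr)] at h
  exact Nat.eq_of_mul_eq_mul_right hτ h

/-- A function on `ZMod (p * τ)` having a nonzero multiple of `τ` as a period has period `τ`. -/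
theorem periodic_of_periodic_mul {F : Type*} {p τ m : ℕ} (hp : p.Prime) (hm0 : 0 < m) (hmp : m < p)
    {b : ZMod (p * τ) → F} (hb : Function.Periodic b ((m * τ : ℕ) : ZMod (p * τ))) :
    Function.Periodic b (τ : ZMod (p * τ)) := by
  have hcop : Nat.Coprime m p := (Nat.coprime_of_lt_prime hm0.ne' hmp hp).symm
  obtain ⟨l, -, hl⟩ := Nat.exists_mul_mod_eq_one_of_coprime hcop hp.one_lt
  have hlτ : l • ((m * τ : ℕ) : ZMod (p * τ)) = (τ : ZMod (p * τ)) := by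
    have hmod : m * l * τ ≡ 1 * τ [MOD p * τ] :=
      Nat.ModEq.mul_right' τ (by rw [Nat.ModEq, hl, Nat.mod_eq_of_lt hp.one_lt])
    have := (ZMod.natCast_eq_natCast_iff _ _ _).2 hmod
    rw [one_mul] at this
    rw [← this, nsmul_eq_mul]
    push_cast
    ring
  exact hlτ ▸ hb.nsmul l

/-- If two rows carry an array whose columns satisfy the parity checks modulo `τ`, a nonzero entry
in one row forces the rows to differ by a multiple of `τ` and to coincide. -/
theorem rows_eq_of_ne_zero {F : Type*} [Field F] [CharP F 2] {p τ n : ℕ} (hτ : 0 < τ) (hp : 0 < p)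
    {a : ZMod (p * τ) → ℕ → F}
    (hcol : ∀ j < n, ∀ μ : ZMod (p * τ),
      ∑ ℓ ∈ Finset.range p, a (μ + ((ℓ * τ : ℕ) : ZMod (p * τ))) j = 0)
    {e₁ e₂ : ZMod (p * τ)}
    (hvanish : ∀ t, ∀ j < n, t ≠ e₁ → t ≠ e₂ → a t j = 0)
    {j₀ : ℕ} (hj₀ : j₀ < n) (ha : a e₁ j₀ ≠ 0) :
    ∃ m, 0 < m ∧ m < p ∧ e₂ = e₁ + ((m * τ : ℕ) : ZMod (p * τ)) ∧
      ∀ j < n, a e₂ j = a e₁ j := by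
  have hne : ∀ l < p, l ≠ 0 → e₁ + ((l * τ : ℕ) : ZMod (p * τ)) ≠ e₁ := by
    intro l hl h0 h
    exact h0 (natCast_mul_injOn_lt hτ hl hp (by simpa using h))
  obtain ⟨m, hm, hm0, he⟩ : ∃ m < p, 0 < m ∧ e₂ = e₁ + ((m * τ : ℕ) : ZMod (p * τ)) := by
    by_contra! hno
    apply ha
    have h := hcol j₀ hj₀ e₁
    rw [Finset.sum_eq_single_of_mem 0 (Finset.mem_range.2 hp)] at h
    · simpa using h
    · intro l hl h0
      rw [Finset.mem_range] at hl
      exact hvanish _ _ hj₀ (hne l hl h0) (hno l hl (Nat.pos_of_ne_zero h0)).symm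
  refine ⟨m, hm0, hm, he, fun j hj => ?_⟩
  have h := hcol j hj e₁
  rw [Finset.sum_eq_add_of_mem 0 m (Finset.mem_range.2 hp) (Finset.mem_range.2 hm) hm0.ne] at h
  · rw [← he] at h
    simpa using (CharTwo.add_eq_zero.1 h).symm
  · rintro l hl ⟨h0, hlm⟩
    rw [Finset.mem_range] at hl
    refine hvanish _ _ hj (hne l hl h0) fun h' => hlm ?_
    rw [he] at h'
    exact natCast_mul_injOn_lt hτ hl hm (add_left_cancel h')

/-- An array carried by two rows, with column parity checks modulo `τ` and parity checks along
lines of slope `ε = ±1`, vanishes on the first of these rows. -/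
theorem row_eq_zero {F : Type*} [Field F] [CharP F 2] {p τ k : ℕ} (hp : p.Prime) (hodd : p ≠ 2)
    (hτ : 0 < τ) (hbig : 2 * (k + 1) < p * τ) {a : ZMod (p * τ) → ℕ → F}
    (hcol : ∀ j < k + 2, ∀ μ : ZMod (p * τ),
      ∑ ℓ ∈ Finset.range p, a (μ + ((ℓ * τ : ℕ) : ZMod (p * τ))) j = 0)
    {ε : ZMod (p * τ)} (hε : ε * ε = 1)
    (hline : ∀ t : ZMod (p * τ), ∑ j ∈ Finset.range (k + 2), a (t - ε * j) j = 0)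
    {e₁ e₂ : ZMod (p * τ)} (he : e₁ ≠ e₂)
    (hvanish : ∀ t, ∀ j < k + 2, t ≠ e₁ → t ≠ e₂ → a t j = 0) :
    ∀ j < k + 2, a e₁ j = 0 := by
  intro j₀ hj₀
  by_contra ha
  obtain ⟨m, hm0, hm, he', hrow⟩ := rows_eq_of_ne_zero hτ hp.pos hcol hvanish hj₀ ha
  have hp3 : 3 ≤ p := by have := hp.two_le; omega
  have hn : 3 * τ ≤ p * τ := Nat.mul_le_mul_right _ hp3
  let b : ZMod (p * τ) → F := fun x =>
    ∑ j ∈ Finset.range (k + 2), if (j : ZMod (p * τ)) = x then a e₁ j else 0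
  have hsplit : ∀ t, b (ε * (t - e₁)) + b (ε * (t - e₂)) = 0 := by
    intro t
    rw [← hline t, ← Finset.sum_add_distrib]
    refine Finset.sum_congr rfl fun j hj => ?_
    rw [Finset.mem_range] at hj
    have hiff : ∀ e, (j : ZMod (p * τ)) = ε * (t - e) ↔ t - ε * j = e := fun e =>
      ⟨fun h => by linear_combination (-ε) * h - (t - e) * hε,
        fun h => by linear_combination (-ε) * h - (j : ZMod (p * τ)) * hε⟩
    simp only [hiff]
    by_cases h1 : t - ε * j = e₁
    · simp [h1, he]
    · by_cases h2 : t - ε * j = e₂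
      · simp [h2, he.symm, hrow j hj]
      · simp [h1, h2, hvanish _ j hj h1 h2]
  have hper : Function.Periodic b ((m * τ : ℕ) : ZMod (p * τ)) := by
    have hperε : Function.Periodic b (ε * ((m * τ : ℕ) : ZMod (p * τ))) := by
      intro x
      have h := hsplit (ε * x + e₂)
      rw [show ε * (ε * x + e₂ - e₂) = x by linear_combination x * hε,
        show ε * (ε * x + e₂ - e₁) = x + ε * ((m * τ : ℕ) : ZMod (p * τ)) by
          rw [he']; linear_combination x * hε] at h
      exact CharTwo.add_eq_zero.1 h
    obtain ⟨s, hs⟩ : ∃ s : ℕ, (s : ZMod (p * τ)) = ε := by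
      have : NeZero (p * τ) := ⟨by omega⟩
      exact ⟨ε.val, ZMod.natCast_zmod_val ε⟩
    have h := hperε.nsmul s
    rwa [nsmul_eq_mul, hs, ← mul_assoc, hε, one_mul] at h
  have hperτ := periodic_of_periodic_mul hp hm0 hm hper
  have hcast : ∀ i < p * τ, ∀ j < k + 2, (j : ZMod (p * τ)) = (i : ZMod (p * τ)) → j = i := by
    intro i hi j hj h
    rwa [ZMod.natCast_eq_natCast_iff', Nat.mod_eq_of_lt (by omega), Nat.mod_eq_of_lt hi] at h
  have hb₀ : b j₀ = a e₁ j₀ := by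
    refine (Finset.sum_eq_single_of_mem j₀ (Finset.mem_range.2 hj₀) fun j hj hne => ?_).trans
      (if_pos rfl)
    exact if_neg fun h => hne (hcast j₀ (by omega) j (Finset.mem_range.1 hj) h)
  apply ha
  set l := (k + 1 - j₀) / τ + 1 with hl
  have hdiv := Nat.div_add_mod (k + 1 - j₀) τ
  have hmod := Nat.mod_lt (k + 1 - j₀) hτ
  have hlτ : l * τ = τ * ((k + 1 - j₀) / τ) + τ := by rw [hl]; ring
  have hshift : b ((j₀ + l * τ : ℕ) : ZMod (p * τ)) = b j₀ := by
    simpa using hperτ.nsmul l j₀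
  rw [← hb₀, ← hshift]
  refine Finset.sum_eq_zero fun j hj => if_neg fun h => ?_
  have := hcast (j₀ + l * τ) (by omega) j (Finset.mem_range.1 hj) h
  have := Finset.mem_range.1 hj
  omega

theorem stmt_18 (F : Type*) [Field F] [CharP F 2]
    (p τ k : ℕ) (hp : p.Prime) (hodd : p ≠ 2) (hτ : 2 ≤ τ) (hk : 1 ≤ k)
    (hbig : 2 * (k + 1) < p * τ)
    (a : ZMod (p * τ) → ℕ → F)
    (hcol : ∀ j < k + 2, ∀ μ : ZMod (p * τ),
      ∑ ℓ ∈ Finset.range p, a (μ + ((ℓ * τ : ℕ) : ZMod (p * τ))) j = 0)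
    (hline : ∀ ℓ < 2, ∀ t : ZMod (p * τ),
      ∑ j ∈ Finset.range (k + 2), a (t - ((ℓ * j : ℕ) : ZMod (p * τ))) j = 0)
    (i : ℕ) (hi : i < 2)
    (e₁ e₂ : ZMod (p * τ)) (he : e₁ ≠ e₂)
    (hvanish : ∀ t : ZMod (p * τ), ∀ j < k + 2,
      t ≠ e₁ - ((i * j : ℕ) : ZMod (p * τ)) →
      t ≠ e₂ - ((i * j : ℕ) : ZMod (p * τ)) → a t j = 0) :
    ∀ t : ZMod (p * τ), ∀ j < k + 2, a t j = 0 := by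
  have hrows : ∀ a' : ZMod (p * τ) → ℕ → F, ∀ ε : ZMod (p * τ), ε * ε = 1 →
      (∀ j < k + 2, ∀ μ : ZMod (p * τ),
        ∑ ℓ ∈ Finset.range p, a' (μ + ((ℓ * τ : ℕ) : ZMod (p * τ))) j = 0) →
      (∀ t : ZMod (p * τ), ∑ j ∈ Finset.range (k + 2), a' (t - ε * j) j = 0) →
      (∀ t, ∀ j < k + 2, t ≠ e₁ → t ≠ e₂ → a' t j = 0) →
      ∀ t, ∀ j < k + 2, a' t j = 0 := by
    intro a' ε hε hc hl hv t j hj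
    by_cases h1 : t = e₁
    · exact h1 ▸ row_eq_zero hp hodd (by omega) hbig hc hε hl he hv j hj
    by_cases h2 : t = e₂
    · exact h2 ▸ row_eq_zero hp hodd (by omega) hbig hc hε hl he.symm
        (fun t j hj h h' => hv t j hj h' h) j hj
    exact hv t j hj h1 h2
  interval_cases i
  · exact hrows a 1 (one_mul 1) hcol (fun t => by simpa using hline 1 one_lt_two t)
      fun t j hj h1 h2 => hvanish t j hj (by simpa using h1) (by simpa using h2)
  · have h := hrows (fun t j => a (t - j) j) (-1) (by ring)
      (fun j hj μ => by simpa [sub_add_eq_add_sub] using hcol j hj (μ - j))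
      (fun t => by simpa using hline 0 two_pos t)
      fun t j hj h1 h2 => hvanish _ j hj (by simpa using h1) (by simpa using h2)
    intro t j hj
    simpa using h (t + j) j hj
end

section
/- Let F be a field of characteristic 2, let p be an odd prime, k ≥ 1, r = 2, and assume τ > k + 1. Let a : Z_{pτ} × {0, …, k+1} → F be an array satisfying (i) Σ_{ℓ=0}^{p−1} a_{μ + ℓτ, j} = 0 for every column j and every μ ∈ Z_{pτ}, and (ii) Σ_{j=0}^{k+1} a_{t − ℓ·j, j} = 0 for ℓ ∈ {0, 1} and every t ∈ Z_{pτ}. Fix a slope i ∈ {0, 1} and three pairwise distinct elements e_1, e_2, e_3 ∈ Z_{pτ}. If a vanishes at every position outside the union of the three lines of slope i through e_1, e_2, e_3, then a is identically zero. Hence GEBR(p, τ, k, 2, q, 1) with τ > k+1 can recover any three erased lines of slope 0 or of slope 1. -/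
/-- A nonzero entry of a finite vanishing sum is accompanied by another one. -/
theorem exists_ne_of_sum_eq_zero {ι M : Type*} [AddCommMonoid M] {s : Finset ι} {f : ι → M}
    (hs : ∑ x ∈ s, f x = 0) {x : ι} (hx : x ∈ s) (hfx : f x ≠ 0) :
    ∃ y ∈ s, y ≠ x ∧ f y ≠ 0 := by
  by_contra! h
  exact hfx (Finset.sum_eq_single_of_mem x hx h ▸ hs)

/-- Two elements of a three-element set that each share their `f`-value with a different element
of the set have the same `f`-value. -/
theorem map_eq_of_partners {α β : Type*} (f : α → β) {e₁ e₂ e₃ x x' y y' : α}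
    (hx : x = e₁ ∨ x = e₂ ∨ x = e₃) (hx' : x' = e₁ ∨ x' = e₂ ∨ x' = e₃)
    (hy : y = e₁ ∨ y = e₂ ∨ y = e₃) (hy' : y' = e₁ ∨ y' = e₂ ∨ y' = e₃)
    (hxx : x' ≠ x) (hyy : y' ≠ y) (hfx : f x' = f x) (hfy : f y' = f y) : f x = f y := by
  grind


theorem stmt_19 (F : Type*) [Field F] [CharP F 2]
    (p τ k : ℕ) (hp : p.Prime) (hodd : p ≠ 2) (hk : 1 ≤ k)
    (hτk : k + 1 < τ)
    (a : ZMod (p * τ) → ℕ → F)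
    (hcol : ∀ j < k + 2, ∀ μ : ZMod (p * τ),
      ∑ ℓ ∈ Finset.range p, a (μ + ((ℓ * τ : ℕ) : ZMod (p * τ))) j = 0)
    (hline : ∀ ℓ < 2, ∀ t : ZMod (p * τ),
      ∑ j ∈ Finset.range (k + 2), a (t - ((ℓ * j : ℕ) : ZMod (p * τ))) j = 0)
    (i : ℕ) (hi : i < 2)
    (e₁ e₂ e₃ : ZMod (p * τ)) (h12 : e₁ ≠ e₂) (h13 : e₁ ≠ e₃) (h23 : e₂ ≠ e₃)
    (hvanish : ∀ t : ZMod (p * τ), ∀ j < k + 2,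
      t ≠ e₁ - ((i * j : ℕ) : ZMod (p * τ)) →
      t ≠ e₂ - ((i * j : ℕ) : ZMod (p * τ)) →
      t ≠ e₃ - ((i * j : ℕ) : ZMod (p * τ)) → a t j = 0) :
    ∀ t : ZMod (p * τ), ∀ j < k + 2, a t j = 0 := by
  set f : ZMod (p * τ) →+* ZMod τ := ZMod.castHom (Dvd.intro_left p rfl) (ZMod τ)
  have hmem : ∀ t, ∀ j < k + 2, a t j ≠ 0 →
      t + ((i * j : ℕ) : ZMod (p * τ)) = e₁ ∨ t + ((i * j : ℕ) : ZMod (p * τ)) = e₂ ∨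
        t + ((i * j : ℕ) : ZMod (p * τ)) = e₃ := by
    intro t j hj hne
    by_contra! h
    exact hne (hvanish t j hj (fun h' => h.1 (eq_sub_iff_add_eq.mp h'))
      (fun h' => h.2.1 (eq_sub_iff_add_eq.mp h')) (fun h' => h.2.2 (eq_sub_iff_add_eq.mp h')))
  have hpartner : ∀ t, ∀ j < k + 2, a t j ≠ 0 → ∃ t', t' ≠ t ∧ a t' j ≠ 0 ∧ f t' = f t := by
    intro t j hj hne
    obtain ⟨ℓ, hℓ, hℓ0, hne'⟩ := exists_ne_of_sum_eq_zero (hcol j hj t)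
      (Finset.mem_range.mpr hp.pos) (by simpa using hne)
    refine ⟨_, ?_, hne', by simp⟩
    intro h
    rw [add_eq_left, ZMod.natCast_eq_zero_iff] at h
    have := Nat.dvd_of_mul_dvd_mul_right (by omega) h
    exact hℓ0 (Nat.eq_zero_of_dvd_of_lt this (Finset.mem_range.mp hℓ))
  have hcongr : ∀ t, ∀ j < k + 2, ∀ t', ∀ j' < k + 2, a t j ≠ 0 → a t' j' ≠ 0 →
      f (t + ((i * j : ℕ) : ZMod (p * τ))) = f (t' + ((i * j' : ℕ) : ZMod (p * τ))) := by
    intro t j hj t' j' hj' hne hne'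
    obtain ⟨u, hu, hune, hfu⟩ := hpartner t j hj hne
    obtain ⟨u', hu', hune', hfu'⟩ := hpartner t' j' hj' hne'
    exact map_eq_of_partners f (hmem t j hj hne) (hmem u j hj hune) (hmem t' j' hj' hne')
      (hmem u' j' hj' hune') (by simpa using hu) (by simpa using hu')
      (by rw [map_add, map_add, hfu]) (by rw [map_add, map_add, hfu'])
  intro t j hj
  by_contra hne
  obtain ⟨j', hj', hjj, hne'⟩ := exists_ne_of_sum_eq_zero
    (hline (1 - i) (by omega) (t + (((1 - i) * j : ℕ) : ZMod (p * τ))))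
    (Finset.mem_range.mpr hj) (by simpa using hne)
  rw [Finset.mem_range] at hj'
  have h := hcongr t j hj _ j' hj' hne hne'
  have hcast : (j : ZMod τ) = j' := by
    interval_cases i
    · simpa [sub_eq_zero, add_sub_assoc] using h.symm
    · simpa using h
  rw [ZMod.natCast_eq_natCast_iff] at hcast
  exact hjj (Nat.ModEq.eq_of_lt_of_lt hcast (by omega) (by omega)).symm
end
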